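/- arXiv:2507.10965 — 4 statements merged into one kernel-verified Lean document; each statement's English description precedes it below -/
import Mathlib

section
/- Let d(n) denote the number of triples (λ, μ, ν), where λ is a partition with no part divisible by 2 and no part divisible by 3, μ and ν are partitions into distinct parts, and |λ| + |μ| + |ν| = n. Then for every natural number n, d(2n) = Σ_{i=0}^{n} d(i) · d(n − i); that is, the sequence (d(n)) is 2-convolutive. -/
namespace CubicTheta

open PowerSeries

/-- The quotient of `q`-factorials `(q)_N² / ((q)_{N+k} (q)_{N-k})`, which vanishes for `k > N`. -/
noncomputable def weight (N : ℕ) : ℕ → ℚ⟦X⟧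
  | 0 => 1
  | k + 1 => weight N k * (1 - X ^ (N - k)) * (1 - X ^ (N + k + 1))⁻¹

lemma one_sub_X_pow_mul_inv (n : ℕ) : (1 - X ^ (n + 1) : ℚ⟦X⟧) * (1 - X ^ (n + 1))⁻¹ = 1 :=
  PowerSeries.mul_inv_cancel _ (by simp)

lemma one_sub_X_pow_ne_zero (n : ℕ) : (1 - X ^ (n + 1) : ℚ⟦X⟧) ≠ 0 :=
  left_ne_zero_of_mul_eq_one (one_sub_X_pow_mul_inv n)

lemma weight_succ_mul (N k : ℕ) :
    weight N (k + 1) * (1 - X ^ (N + k + 1)) = weight N k * (1 - X ^ (N - k)) := by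
  rw [weight]
  linear_combination (weight N k * (1 - X ^ (N - k))) * one_sub_X_pow_mul_inv (N + k)

lemma weight_self_succ (N : ℕ) : weight N (N + 1) = 0 := by
  simp [weight]

lemma weight_succ_left_mul (N k : ℕ) (hk : k ≤ N + 1) :
    weight (N + 1) k * (1 - X ^ (N + 1 + k)) * (1 - X ^ (N + 1 - k)) =
      (1 - X ^ (N + 1)) ^ 2 * weight N k := by
  induction k with
  | zero => simp [weight]; ring
  | succ k ih =>
    have h := ih (by omega)
    have h1 := weight_succ_mul (N + 1) k
    have h2 := weight_succ_mul N k
    obtain ⟨v, rfl⟩ := Nat.exists_eq_add_of_le (show k ≤ N by omega)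
    rw [show k + v + 1 - (k + 1) = v by omega] at *
    rw [show k + v + 1 - k = v + 1 by omega] at h h1
    rw [show k + v - k = v by omega] at h2
    apply mul_right_cancel₀ (one_sub_X_pow_ne_zero (k + v + k))
    rw [show k + v + 1 + (k + 1) = k + v + 1 + k + 1 by omega]
    rw [show k + v + 1 + k = k + v + k + 1 by omega] at *
    linear_combination (1 - X ^ v) * (1 - X ^ (k + v + k + 1)) * h1 -
      (1 - X ^ (k + v + 1)) ^ 2 * h2 + (1 - X ^ v) * h

lemma X_pow_dvd_weight_sub_one (N k : ℕ) : (X : ℚ⟦X⟧) ^ (N + 1 - k) ∣ weight N k - 1 := by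
  induction k with
  | zero => simp [weight]
  | succ k ih =>
    rw [show N + 1 - (k + 1) = N - k by omega]
    have h0 : (X : ℚ⟦X⟧) ^ (N - k) ∣ weight N k - 1 :=
      (pow_dvd_pow _ (by omega)).trans ih
    have h1 : (X : ℚ⟦X⟧) ^ (N - k) ∣ X ^ (N + k + 1) := pow_dvd_pow _ (by omega)
    have h2 := one_sub_X_pow_mul_inv (N + k)
    have h3 : weight N (k + 1) - 1 = (weight N k - 1) * (1 - X ^ (N + k + 1))⁻¹
        - X ^ (N - k) * (weight N k * (1 - X ^ (N + k + 1))⁻¹)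
        + X ^ (N + k + 1) * (1 - X ^ (N + k + 1))⁻¹ := by
      rw [weight]
      linear_combination h2
    rw [h3]
    exact dvd_add (dvd_sub (h0.mul_right _) (dvd_mul_right _ _)) (h1.mul_right _)

lemma sum_weight_telescope (M K : ℕ) (hK : K ≤ M) :
    (X - X ^ M) * ∑ k ∈ Finset.range K, (-1) ^ k * X ^ ((k + 1).choose 2) * X ^ (M - (k + 1)) *
      (1 - X ^ (2 * (k + 1))) * (1 - X ^ (k + 1)) * weight M (k + 1) =
    (-1) ^ (K + 1) * X ^ (K.choose 2) * X ^ M * (X ^ (K + 1) - 1) * (X ^ K - 1) *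
      (1 - X ^ (M - K)) * weight M K := by
  induction K with
  | zero => simp
  | succ K ih =>
    rw [Finset.sum_range_succ, mul_add, ih (by omega)]
    have h := weight_succ_mul M K
    obtain ⟨v, rfl⟩ := Nat.exists_eq_add_of_le hK
    rw [show K + 1 + v - K = v + 1 by omega] at *
    rw [show K + 1 + v - (K + 1) = v by omega] at *
    rw [show (K + 1).choose 2 = K + K.choose 2 by simp [Nat.choose_succ_succ' K 1]]
    linear_combination (-1) ^ K * X ^ (K.choose 2) * X ^ (K + 1 + v) * (X ^ (K + 1) - 1) *
      (X ^ K - 1) * h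

lemma sum_weight_eq_zero (N : ℕ) :
    ∑ k ∈ Finset.range (N + 2), (-1) ^ k * X ^ ((k + 1).choose 2) * X ^ (N + 2 - (k + 1)) *
      (1 - X ^ (2 * (k + 1))) * (1 - X ^ (k + 1)) * weight (N + 2) (k + 1) = 0 := by
  have h := sum_weight_telescope (N + 2) (N + 2) le_rfl
  have hX : (X - X ^ (N + 2) : ℚ⟦X⟧) ≠ 0 := by
    rw [show (X - X ^ (N + 2) : ℚ⟦X⟧) = X * (1 - X ^ (N + 1)) by ring]
    exact mul_ne_zero X_ne_zero (one_sub_X_pow_ne_zero N)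
  exact (mul_eq_zero.1 (h.trans (by simp))).resolve_left hX

/-- The common term of the partial fraction expansions of `(q)_N³ / (q³;q³)_N`. -/
noncomputable def partialFraction (k : ℕ) : ℚ⟦X⟧ :=
  (-1) ^ k * X ^ ((k + 1).choose 2) * (1 - X ^ (2 * (k + 1))) * (1 - X ^ (k + 1)) ^ 2 *
    (1 - X ^ (3 * (k + 1)))⁻¹

/-- The weighted partial sum whose value is `(q)_N³ / (q³;q³)_N`. -/
noncomputable def weightedSum (N : ℕ) : ℚ⟦X⟧ :=
  ∑ k ∈ Finset.range N, partialFraction k * weight N (k + 1)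

lemma weightedSum_succ (N : ℕ) :
    (1 - X ^ (3 * (N + 2))) * weightedSum (N + 2) = (1 - X ^ (N + 2)) ^ 3 * weightedSum (N + 1) := by
  have hext : weightedSum (N + 1) =
      ∑ k ∈ Finset.range (N + 2), partialFraction k * weight (N + 1) (k + 1) := by
    rw [Finset.sum_range_succ, weight_self_succ, mul_zero, add_zero, weightedSum]
  rw [hext, weightedSum, Finset.mul_sum, Finset.mul_sum, ← sub_eq_zero, ← Finset.sum_sub_distrib]
  trans (1 - X ^ (N + 2)) * ∑ k ∈ Finset.range (N + 2),
      (-1) ^ k * X ^ ((k + 1).choose 2) * X ^ (N + 2 - (k + 1)) *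
      (1 - X ^ (2 * (k + 1))) * (1 - X ^ (k + 1)) * weight (N + 2) (k + 1)
  · rw [Finset.mul_sum]
    refine Finset.sum_congr rfl fun k hk ↦ ?_
    have hk' : k + 1 ≤ N + 2 := by have := Finset.mem_range.1 hk; omega
    have h := weight_succ_left_mul (N + 1) (k + 1) hk'
    have h2 := one_sub_X_pow_mul_inv (3 * k + 2)
    rw [show 3 * k + 2 + 1 = 3 * (k + 1) by ring] at h2
    rw [partialFraction]
    generalize (1 - X ^ (3 * (k + 1)) : ℚ⟦X⟧)⁻¹ = i at *
    rw [show N + 1 + 1 = N + 2 by ring] at h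
    obtain ⟨v, hv⟩ := Nat.exists_eq_add_of_le hk'
    rw [hv] at h ⊢
    rw [show k + 1 + v - (k + 1) = v by omega] at h ⊢
    generalize weight (k + 1 + v) (k + 1) = w at *
    generalize weight (N + 1) (k + 1) = w' at *
    linear_combination
      ((-1) ^ k * X ^ ((k + 1).choose 2) * (1 - X ^ (2 * (k + 1))) * (1 - X ^ (k + 1)) ^ 2 * i *
        (1 - X ^ (k + 1 + v))) * h + ((1 - X ^ (k + 1 + v)) * (-1) ^ k * X ^ ((k + 1).choose 2) *
          X ^ v * (1 - X ^ (2 * (k + 1))) * (1 - X ^ (k + 1)) * w) * h2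
  · rw [sum_weight_eq_zero, mul_zero]

lemma weightedSum_one : (1 - X ^ 3) * weightedSum 1 = (1 - X) ^ 3 := by
  have h := weight_succ_mul 1 0
  have h2 : (1 - X ^ 3 : ℚ⟦X⟧) * (1 - X ^ 3)⁻¹ = 1 := one_sub_X_pow_mul_inv 2
  simp only [weightedSum, partialFraction, weight, Finset.sum_range_one] at h ⊢
  norm_num at h ⊢
  generalize (1 - X ^ 3 : ℚ⟦X⟧)⁻¹ = i at *
  linear_combination ((1 - X) ^ 2 * (1 - X ^ 3) * i) * h + ((1 - X) ^ 3) * h2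

/-- The finite product `(q)_N`. -/
noncomputable def eulerProd (N : ℕ) : ℚ⟦X⟧ := ∏ i ∈ Finset.range N, (1 - X ^ (i + 1))

lemma expand_eulerProd (c : ℕ) (hc : c ≠ 0) (N : ℕ) :
    expand c hc (eulerProd N) = ∏ i ∈ Finset.range N, (1 - X ^ (c * (i + 1))) := by
  simp [eulerProd, pow_mul]

lemma weightedSum_mul_eulerProd (N : ℕ) (hN : N ≠ 0) :
    weightedSum N * expand 3 (by simp) (eulerProd N) = eulerProd N ^ 3 := by
  rw [expand_eulerProd, eulerProd]
  induction N with
  | zero => contradiction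
  | succ N ih =>
    rcases N with _ | N
    · have := weightedSum_one
      simp
      linear_combination this
    · have h := ih (by simp)
      have h1 := weightedSum_succ N
      rw [Finset.prod_range_succ, Finset.prod_range_succ _ (N + 1)]
      linear_combination (∏ i ∈ Finset.range (N + 1), (1 - X ^ (3 * (i + 1)))) * h1 +
        (1 - X ^ (N + 2)) ^ 3 * h

lemma sum_X_pow_choose_telescope (N : ℕ) :
    ∑ k ∈ Finset.range N, (-1 : ℚ⟦X⟧) ^ k * X ^ ((k + 1).choose 2) * (1 + X ^ (k + 1)) =
      1 + (-1) ^ (N + 1) * X ^ ((N + 1).choose 2) := by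
  induction N with
  | zero => simp
  | succ N ih =>
    rw [Finset.sum_range_succ, ih,
      show (N + 1 + 1).choose 2 = N + 1 + (N + 1).choose 2 by simp [Nat.choose_succ_succ' (N + 1) 1]]
    ring

lemma le_choose_two (k : ℕ) : k ≤ (k + 1).choose 2 := by
  simp [Nat.choose_succ_succ' k 1]

lemma X_pow_dvd_weightedSum_sub (N : ℕ) :
    (X : ℚ⟦X⟧) ^ N ∣ weightedSum N - ∑ k ∈ Finset.range N, partialFraction k := by
  rw [weightedSum, ← Finset.sum_sub_distrib]
  refine Finset.dvd_sum fun k hk ↦ ?_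
  have hk := Finset.mem_range.1 hk
  rw [show partialFraction k * weight N (k + 1) - partialFraction k =
    X ^ ((k + 1).choose 2) * (weight N (k + 1) - 1) *
    ((-1) ^ k * (1 - X ^ (2 * (k + 1))) * (1 - X ^ (k + 1)) ^ 2 *
    (1 - X ^ (3 * (k + 1)))⁻¹) by rw [partialFraction]; ring]
  refine Dvd.dvd.mul_right ?_ _
  refine (pow_dvd_pow X (m := N) (n := (k + 1).choose 2 + (N + 1 - (k + 1))) ?_).trans ?_
  · have := le_choose_two k
    omega
  · rw [pow_add]
    exact mul_dvd_mul_left _ (X_pow_dvd_weight_sub_one N (k + 1))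

/-- The nontrivial character modulo `3`. -/
def chi (z : ℤ) : ℚ := if z % 3 = 1 then 1 else if z % 3 = 2 then -1 else 0

lemma chi_neg (z : ℤ) : chi (-z) = -chi z := by
  unfold chi
  have h : z % 3 = 0 ∨ z % 3 = 1 ∨ z % 3 = 2 := by omega
  rcases h with h | h | h
  · simp [h, show (-z) % 3 = 0 by omega]
  · simp [h, show (-z) % 3 = 2 by omega]
  · simp [h, show (-z) % 3 = 1 by omega]

lemma chi_congr {a b : ℤ} (h : a % 3 = b % 3) : chi a = chi b := by
  simp [chi, h]

/-- The expansion of `(1 - X²) / (1 - X³)`. -/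
noncomputable def period : ℚ⟦X⟧ := mk fun j ↦ chi (2 * j + 1)

lemma period_mul : period * (1 - X ^ 3) = 1 - X ^ 2 := by
  ext n
  rw [mul_sub, mul_one, map_sub, coeff_mul_X_pow', map_sub, coeff_X_pow, coeff_one, period,
    coeff_mk]
  rcases n with _ | _ | _ | n
  · norm_num [chi]
  · norm_num [chi]
  · norm_num [chi]
  · simp only [show 3 ≤ n + 1 + 1 + 1 by omega, if_true, coeff_mk]
    rw [chi_congr (b := 2 * ((n + 1 + 1 + 1 - 3 : ℕ) : ℤ) + 1)]
    · simp
    · push_cast [show n + 1 + 1 + 1 - 3 = n by omega]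
      omega

lemma partialFraction_eq (k : ℕ) : partialFraction k = (-1) ^ k * X ^ ((k + 1).choose 2) * (1 + X ^ (k + 1)) -
    3 * ((-1) ^ k * X ^ ((k + 2).choose 2) * expand (k + 1) k.succ_ne_zero period) := by
  have h := congrArg (expand (k + 1) k.succ_ne_zero) period_mul
  simp only [map_mul, map_sub, map_one, map_pow, expand_X, ← pow_mul] at h
  have h2 := one_sub_X_pow_mul_inv (3 * k + 2)
  rw [show 3 * k + 2 + 1 = (k + 1) * 3 by ring] at h2
  rw [partialFraction, show (k + 2).choose 2 = k + 1 + (k + 1).choose 2 by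
    simp [Nat.choose_succ_succ' (k + 1) 1], mul_comm 3 (k + 1), mul_comm 2 (k + 1)]
  generalize (1 - X ^ ((k + 1) * 3) : ℚ⟦X⟧)⁻¹ = i at *
  linear_combination ((-1) ^ k * X ^ ((k + 1).choose 2) * (1 + X ^ (k + 1)) -
    3 * ((-1) ^ k * X ^ (k + 1 + (k + 1).choose 2) * expand (k + 1) k.succ_ne_zero period)) * h2 +
    3 * ((-1) ^ k * X ^ (k + 1 + (k + 1).choose 2)) * i * h

/-- The sum of `chi (n - 2 m / n)` over the odd divisors `n` of `m`. -/
def oddDivisorSum (m : ℕ) : ℚ :=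
  ∑ n ∈ m.divisors with Odd n, chi ((n : ℤ) - ((2 * m / n : ℕ) : ℤ))

/-- The cubic theta function `b(q)`, given by its Lambert series. -/
noncomputable def theta : ℚ⟦X⟧ := 1 + 3 * mk oddDivisorSum

open scoped Classical in
lemma coeff_X_pow_mul_expand (k m : ℕ) :
    coeff m (X ^ ((k + 2).choose 2) * expand (k + 1) k.succ_ne_zero period) =
      if ∃ j, (k + 1) * (k + 2 + 2 * j) = 2 * m then
        chi (((2 * m / (k + 1) : ℕ) : ℤ) - (k + 1)) else 0 := by
  have hch : 2 * (k + 2).choose 2 = (k + 1) * (k + 2) := by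
    have := Nat.triangle_succ (k + 1)
    rw [Nat.choose_two_right, mul_comm (k + 1), Nat.mul_div_cancel' (Nat.even_mul_pred_self _).two_dvd]
    rfl
  rw [coeff_X_pow_mul', coeff_expand]
  split_ifs with h1 h2 h3 h3 h3
  · obtain ⟨j, hj⟩ := h3
    have : m - (k + 2).choose 2 = (k + 1) * j := by
      zify [h1] at *
      linarith
    rw [this, Nat.mul_div_cancel_left _ k.succ_pos, ← hj, Nat.mul_div_cancel_left _ k.succ_pos,
      period, coeff_mk]
    congr 1
    push_cast
    ring
  · obtain ⟨j, hj⟩ := h2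
    refine absurd ⟨j, ?_⟩ h3
    zify [h1] at *
    linarith
  · obtain ⟨j, hj⟩ := h3
    refine absurd ⟨j, ?_⟩ h2
    zify [h1] at *
    linarith
  · rfl
  · obtain ⟨j, hj⟩ := h3
    nlinarith
  · rfl

open scoped Classical in
lemma sum_chi_eq_oddDivisorSum (N m : ℕ) (hm : m < N) :
    ∑ k ∈ Finset.range N, (-1) ^ k * (if ∃ j, (k + 1) * (k + 2 + 2 * j) = 2 * m then
        chi (((2 * m / (k + 1) : ℕ) : ℤ) - (k + 1)) else 0) = - oddDivisorSum m := by
  rcases Nat.eq_zero_or_pos m with rfl | hpos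
  · simp [oddDivisorSum]
  rw [oddDivisorSum, ← Finset.sum_neg_distrib]
  simp_rw [mul_ite, mul_zero]
  rw [← Finset.sum_filter]
  refine Finset.sum_bij' (fun k _ ↦ if Even k then k + 1 else 2 * m / (k + 1))
    (fun n _ ↦ min n (2 * m / n) - 1) ?_ ?_ ?_ ?_ ?_
  · intro k hk
    obtain ⟨-, j, hj⟩ := Finset.mem_filter.1 hk
    rw [← hj, Nat.mul_div_cancel_left _ k.succ_pos]
    rw [Finset.mem_filter, Nat.mem_divisors]
    split_ifs with h
    · obtain ⟨a, rfl⟩ := h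
      exact ⟨⟨⟨a + 1 + j, by linarith⟩, hpos.ne'⟩, ⟨a, by ring⟩⟩
    · obtain ⟨a, rfl⟩ := Nat.not_even_iff_odd.1 h
      exact ⟨⟨⟨a + 1, by linarith⟩, hpos.ne'⟩, ⟨a + 1 + j, by ring⟩⟩
  · intro n hn
    obtain ⟨hn, b, hb⟩ := Finset.mem_filter.1 hn
    obtain ⟨⟨c, rfl⟩, -⟩ := Nat.mem_divisors.1 hn
    have hn0 : 0 < n := by omega
    have hc0 : 0 < c := Nat.pos_of_mul_pos_left hpos
    rw [show 2 * (n * c) = n * (2 * c) by ring, Nat.mul_div_cancel_left _ hn0, Finset.mem_filter,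
      Finset.mem_range]
    rcases le_total n (2 * c) with h | h
    · rw [min_eq_left h]
      refine ⟨by nlinarith [Nat.sub_le n 1], c - b - 1, ?_⟩
      rw [show n - 1 + 1 = n by omega]
      congr 1
      omega
    · rw [min_eq_right h]
      refine ⟨by have : n * c ≥ 2 * c * c := Nat.mul_le_mul_right _ h
                 have : 2 * c * c ≥ 2 * c * 1 := Nat.mul_le_mul_left _ hc0
                 omega, b - c, ?_⟩
      rw [show 2 * c - 1 + 1 = 2 * c by omega, mul_comm n]
      congr 1
      omega
  · intro k hk
    obtain ⟨-, j, hj⟩ := Finset.mem_filter.1 hk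
    rw [← hj, Nat.mul_div_cancel_left _ k.succ_pos]
    split_ifs with h
    · rw [Nat.mul_div_cancel_left _ k.succ_pos]
      omega
    · rw [Nat.mul_div_cancel _ (by omega)]
      omega
  · intro n hn
    obtain ⟨hn, b, hb⟩ := Finset.mem_filter.1 hn
    obtain ⟨⟨c, rfl⟩, -⟩ := Nat.mem_divisors.1 hn
    have hn0 : 0 < n := by omega
    have hc0 : 0 < c := Nat.pos_of_mul_pos_left hpos
    rw [show 2 * (n * c) = n * (2 * c) by ring, Nat.mul_div_cancel_left _ hn0]
    rcases le_total n (2 * c) with h | h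
    · rw [min_eq_left h, if_pos ⟨b, by omega⟩]
      omega
    · rw [min_eq_right h, if_neg (by rw [Nat.not_even_iff_odd]; exact ⟨c - 1, by omega⟩),
        show 2 * c - 1 + 1 = 2 * c by omega, Nat.mul_div_cancel _ (by omega)]
  · intro k hk
    obtain ⟨-, j, hj⟩ := Finset.mem_filter.1 hk
    rw [← hj, Nat.mul_div_cancel_left _ k.succ_pos]
    split_ifs with h
    · rw [Nat.mul_div_cancel_left _ k.succ_pos, h.neg_one_pow, one_mul, ← chi_neg]
      congr 1
      push_cast
      ring
    · rw [Nat.mul_div_cancel _ (by omega), (Nat.not_even_iff_odd.1 h).neg_one_pow, neg_one_mul]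
      push_cast
      rfl

lemma X_pow_dvd_theta_sub (N : ℕ) : (X : ℚ⟦X⟧) ^ N ∣ weightedSum N - theta := by
  have h1 := X_pow_dvd_weightedSum_sub N
  have h2 : (X : ℚ⟦X⟧) ^ N ∣ X ^ ((N + 1).choose 2) := pow_dvd_pow _ (le_choose_two N)
  have h3 : (X : ℚ⟦X⟧) ^ N ∣ (∑ k ∈ Finset.range N, ((-1) ^ k * X ^ ((k + 2).choose 2) *
      expand (k + 1) k.succ_ne_zero period)) + mk oddDivisorSum := by
    rw [X_pow_dvd_iff]
    intro m hm
    classical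
    rw [map_add, map_sum, coeff_mk, ← eq_neg_iff_add_eq_zero, ← sum_chi_eq_oddDivisorSum N m hm]
    refine Finset.sum_congr rfl fun k _ ↦ ?_
    rw [← coeff_X_pow_mul_expand, ← coeff_C_mul, mul_assoc]
    simp
  have h : weightedSum N - theta = (weightedSum N - ∑ k ∈ Finset.range N, partialFraction k) +
      X ^ ((N + 1).choose 2) * (-1) ^ (N + 1) - 3 * ((∑ k ∈ Finset.range N, ((-1) ^ k *
      X ^ ((k + 2).choose 2) * expand (k + 1) k.succ_ne_zero period)) + mk oddDivisorSum) := by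
    simp_rw [partialFraction_eq, Finset.sum_sub_distrib, sum_X_pow_choose_telescope, ← Finset.mul_sum, theta]
    ring
  rw [h]
  exact dvd_sub (dvd_add h1 (h2.mul_right _)) (h3.mul_left _)

lemma oddDivisorSum_four_mul (m : ℕ) : oddDivisorSum (4 * m) = oddDivisorSum m := by
  rcases Nat.eq_zero_or_pos m with rfl | hpos
  · rfl
  have hf : (4 * m).divisors.filter Odd = m.divisors.filter Odd := by
    ext n
    simp only [Finset.mem_filter, Nat.mem_divisors]
    constructor
    · rintro ⟨⟨h, -⟩, ho⟩
      have h4 : Nat.Coprime n 4 := (Nat.coprime_two_right.2 ho).pow_right 2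
      exact ⟨⟨h4.dvd_of_dvd_mul_left h, hpos.ne'⟩, ho⟩
    · rintro ⟨⟨h, -⟩, ho⟩
      exact ⟨⟨h.mul_left 4, by omega⟩, ho⟩
  rw [oddDivisorSum, hf, oddDivisorSum]
  refine Finset.sum_congr rfl fun n hn ↦ chi_congr ?_
  obtain ⟨hn, ho⟩ := Finset.mem_filter.1 hn
  obtain ⟨⟨c, rfl⟩, -⟩ := Nat.mem_divisors.1 hn
  rw [show 2 * (4 * (n * c)) = n * (8 * c) by ring, show 2 * (n * c) = n * (2 * c) by ring,
    Nat.mul_div_cancel_left _ ho.pos, Nat.mul_div_cancel_left _ ho.pos]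
  omega

lemma oddDivisorSum_two_mul_odd (m : ℕ) (hm : Odd m) : oddDivisorSum (2 * m) = 0 := by
  have hf : (2 * m).divisors.filter Odd = m.divisors := by
    ext n
    simp only [Finset.mem_filter, Nat.mem_divisors]
    constructor
    · rintro ⟨⟨h, -⟩, ho⟩
      exact ⟨(Nat.coprime_two_right.2 ho).dvd_of_dvd_mul_left h, hm.pos.ne'⟩
    · rintro ⟨h, -⟩
      exact ⟨⟨h.mul_left 2, by have := hm.pos; omega⟩, hm.of_dvd_nat h⟩
  have h1 : oddDivisorSum (2 * m) = ∑ n ∈ m.divisors, chi ((n : ℤ) - ((m / n : ℕ) : ℤ)) := by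
    rw [oddDivisorSum, hf]
    refine Finset.sum_congr rfl fun n hn ↦ chi_congr ?_
    obtain ⟨⟨c, rfl⟩, -⟩ := Nat.mem_divisors.1 hn
    have hn0 := Nat.pos_of_mem_divisors hn
    rw [show 2 * (2 * (n * c)) = n * (4 * c) by ring, Nat.mul_div_cancel_left _ hn0,
      Nat.mul_div_cancel_left _ hn0]
    omega
  have h2 := Nat.sum_div_divisors m fun n ↦ chi ((n : ℤ) - ((m / n : ℕ) : ℤ))
  have h3 : ∑ d ∈ m.divisors, chi (((m / d : ℕ) : ℤ) - ((m / (m / d) : ℕ) : ℤ)) =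
      - ∑ n ∈ m.divisors, chi ((n : ℤ) - ((m / n : ℕ) : ℤ)) := by
    rw [← Finset.sum_neg_distrib]
    refine Finset.sum_congr rfl fun n hn ↦ ?_
    rw [Nat.div_div_self (Nat.dvd_of_mem_divisors hn) hm.pos.ne', ← chi_neg, neg_sub]
  linarith

lemma coeff_evalNegHom (f : ℚ⟦X⟧) (n : ℕ) : coeff n (evalNegHom f) = (-1) ^ n * coeff n f := by
  rw [evalNegHom, coeff_rescale]

lemma evalNegHom_expand_two (f : ℚ⟦X⟧) :
    evalNegHom (expand 2 two_ne_zero f) = expand 2 two_ne_zero f := by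
  ext n
  rw [coeff_evalNegHom, coeff_expand]
  split_ifs with h
  · rw [(even_iff_two_dvd.2 h).neg_one_pow, one_mul]
  · simp

lemma evalNegHom_expand_three (f : ℚ⟦X⟧) :
    evalNegHom (expand 3 three_ne_zero f) = expand 3 three_ne_zero (evalNegHom f) := by
  ext n
  rw [coeff_evalNegHom, coeff_expand, coeff_expand]
  split_ifs with h
  · obtain ⟨c, rfl⟩ := h
    rw [Nat.mul_div_cancel_left _ (by simp), coeff_evalNegHom, pow_mul]
    norm_num
  · simp

/-- The even part of `b(q)` is `b(q⁴)`. -/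
lemma theta_add_evalNegHom : theta + evalNegHom theta = 2 * expand 4 four_ne_zero theta := by
  suffices h : (mk oddDivisorSum : ℚ⟦X⟧) + evalNegHom (mk oddDivisorSum) =
      2 * expand 4 four_ne_zero (mk oddDivisorSum) by
    have e3 : (expand 4 four_ne_zero (3 : ℚ⟦X⟧)) = 3 := map_ofNat _ 3
    have n3 : evalNegHom (3 : ℚ⟦X⟧) = 3 := map_ofNat _ 3
    simp only [theta, map_add, map_mul, map_one, e3, n3]
    linear_combination 3 * h
  ext n
  rw [map_add, coeff_evalNegHom, two_mul, map_add, coeff_expand, coeff_mk, coeff_mk]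
  split_ifs with h
  · obtain ⟨c, rfl⟩ := h
    rw [Nat.mul_div_cancel_left _ (by simp), oddDivisorSum_four_mul, pow_mul]
    norm_num
  · rcases Nat.even_or_odd n with he | ho
    · obtain ⟨c, rfl⟩ := he.two_dvd
      rw [oddDivisorSum_two_mul_odd c (by rw [← Nat.not_even_iff_odd]; rintro ⟨a, rfl⟩; omega)]
      simp
    · rw [ho.neg_one_pow]
      ring

open scoped PowerSeries.WithPiTopology
open Filter Topology

/-- The Euler product `(q;q)_∞`. -/
noncomputable def euler : ℚ⟦X⟧ := ∏' i : ℕ, (1 - X ^ (i + 1))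

lemma tendsto_eulerProd : Tendsto eulerProd atTop (𝓝 euler) :=
  (WithPiTopology.multipliable_one_sub_X_pow ℚ).hasProd.tendsto_prod_nat

lemma euler_ne_zero : euler ≠ 0 := WithPiTopology.tprod_one_sub_X_pow_ne_zero ℚ

lemma continuous_expand (c : ℕ) (hc : c ≠ 0) : Continuous (expand c hc : ℚ⟦X⟧ → ℚ⟦X⟧) := by
  rw [continuous_iff_continuousAt]
  intro f
  rw [ContinuousAt, WithPiTopology.tendsto_iff_coeff_tendsto]
  intro n
  simp_rw [coeff_expand]
  split_ifs
  · exact (WithPiTopology.continuous_coeff ℚ _).tendsto f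
  · exact tendsto_const_nhds

lemma continuous_evalNegHom : Continuous (evalNegHom : ℚ⟦X⟧ → ℚ⟦X⟧) := by
  rw [continuous_iff_continuousAt]
  intro f
  rw [ContinuousAt, WithPiTopology.tendsto_iff_coeff_tendsto]
  intro n
  simp_rw [coeff_evalNegHom]
  exact ((WithPiTopology.continuous_coeff ℚ _).tendsto f).const_mul _

lemma expand_ne_zero {c : ℕ} (hc : c ≠ 0) {f : ℚ⟦X⟧} (hf : f ≠ 0) : expand c hc f ≠ 0 := by
  contrapose! hf
  ext n
  rw [← coeff_expand_mul c hc, hf]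
  simp

lemma tendsto_expand_eulerProd (c : ℕ) (hc : c ≠ 0) :
    Tendsto (fun N ↦ expand c hc (eulerProd N)) atTop (𝓝 (expand c hc euler)) :=
  ((continuous_expand c hc).tendsto _).comp tendsto_eulerProd

lemma tendsto_weightedSum : Tendsto weightedSum atTop (𝓝 theta) := by
  rw [WithPiTopology.tendsto_iff_coeff_tendsto]
  intro n
  refine tendsto_atTop_of_eventually_const (i₀ := n + 1) fun N hN ↦ ?_
  rw [← sub_eq_zero, ← map_sub]
  exact X_pow_dvd_iff.1 (X_pow_dvd_theta_sub N) n (by omega)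

/-- The product formula `b(q) = (q;q)³ / (q³;q³)`. -/
lemma theta_mul_expand_euler : theta * expand 3 three_ne_zero euler = euler ^ 3 :=
  tendsto_nhds_unique_of_eventuallyEq
    (tendsto_weightedSum.mul (tendsto_expand_eulerProd 3 three_ne_zero))
    (tendsto_eulerProd.pow 3)
    ((eventually_ne_atTop 0).mono fun N hN ↦ weightedSum_mul_eulerProd N hN)

lemma eulerProd_mul_evalNegHom (N : ℕ) :
    eulerProd (2 * N) * evalNegHom (eulerProd (2 * N)) * expand 4 four_ne_zero (eulerProd N) =
      expand 2 two_ne_zero (eulerProd N) ^ 2 * expand 2 two_ne_zero (eulerProd (2 * N)) := by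
  simp only [expand_eulerProd]
  simp only [eulerProd, map_prod, map_sub, map_one, map_pow, evalNegHom_X]
  induction N with
  | zero => simp
  | succ N ih =>
    simp only [show 2 * (N + 1) = 2 * N + 1 + 1 by ring, Finset.prod_range_succ]
    have h1 : (-X : ℚ⟦X⟧) ^ (2 * N + 1) = -X ^ (2 * N + 1) := Odd.neg_pow ⟨N, rfl⟩ X
    have h2 : (-X : ℚ⟦X⟧) ^ (2 * N + 1 + 1) = X ^ (2 * N + 2) := Even.neg_pow ⟨N + 1, by ring⟩ X
    rw [h1, h2]
    linear_combination (1 - X ^ (2 * N + 1)) * (1 - X ^ (2 * N + 2)) * (1 + X ^ (2 * N + 1)) *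
      (1 - X ^ (2 * N + 2)) * (1 - X ^ (4 * (N + 1))) * ih

lemma tendsto_two_mul : Tendsto (fun N : ℕ ↦ 2 * N) atTop atTop :=
  tendsto_id.const_mul_atTop' (by simp)

lemma euler_mul_evalNegHom :
    euler * evalNegHom euler * expand 4 four_ne_zero euler = expand 2 two_ne_zero euler ^ 3 := by
  have h := tendsto_nhds_unique_of_eventuallyEq
    (((tendsto_eulerProd.comp tendsto_two_mul).mul
      ((continuous_evalNegHom.tendsto _).comp (tendsto_eulerProd.comp tendsto_two_mul))).mul
        (tendsto_expand_eulerProd 4 four_ne_zero))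
    (((tendsto_expand_eulerProd 2 two_ne_zero).pow 2).mul
      ((tendsto_expand_eulerProd 2 two_ne_zero).comp tendsto_two_mul))
    (.of_forall eulerProd_mul_evalNegHom)
  rw [h, ← pow_succ]

lemma expand_expand {a b c : ℕ} (ha : a ≠ 0) (hb : b ≠ 0) (hc : c ≠ 0) (h : c = a * b)
    (f : ℚ⟦X⟧) : expand a ha (expand b hb f) = expand c hc f := by
  subst h
  rw [expand_mul]

lemma evalNegHom_ne_zero {f : ℚ⟦X⟧} (hf : f ≠ 0) : evalNegHom f ≠ 0 := by
  contrapose! hf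
  ext n
  have := coeff_evalNegHom f n
  rw [hf, map_zero] at this
  simpa using this.symm

lemma theta_ne_zero : theta ≠ 0 :=
  left_ne_zero_of_mul (theta_mul_expand_euler.trans_ne (pow_ne_zero 3 euler_ne_zero))

lemma theta_mul_evalNegHom :
    theta * evalNegHom theta * expand 4 four_ne_zero theta = expand 2 two_ne_zero theta ^ 3 := by
  have h1 := theta_mul_expand_euler
  have h2 := congrArg (expand 2 two_ne_zero) h1
  have h4 := congrArg (expand 4 four_ne_zero) h1
  have hn := congrArg evalNegHom h1
  have e1 := euler_mul_evalNegHom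
  have e3 := congrArg (expand 3 three_ne_zero) e1
  simp only [map_mul, map_pow, evalNegHom_expand_three] at h2 h4 hn e3
  rw [expand_expand (c := 6) _ _ (by simp) rfl] at h2
  rw [expand_expand (c := 12) _ _ (by simp) rfl] at h4
  rw [expand_expand (c := 12) _ _ (by simp) rfl, expand_expand (c := 6) _ _ (by simp) rfl] at e3
  apply mul_right_cancel₀ (pow_ne_zero 3 (expand_ne_zero (c := 6) (by simp) euler_ne_zero))
  calc _ = (theta * expand 3 three_ne_zero euler) *
        (evalNegHom theta * expand 3 three_ne_zero (evalNegHom euler)) *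
        (expand 4 four_ne_zero theta * expand 12 (by simp) euler) := by rw [← e3]; ring
    _ = (euler * evalNegHom euler * expand 4 four_ne_zero euler) ^ 3 := by rw [h1, hn, h4]; ring
    _ = (expand 2 two_ne_zero theta * expand 6 (by simp) euler) ^ 3 := by rw [e1, h2]
    _ = _ := by ring

/-- If `f = b(q²) / b(q)`, then the even part of `f` is `f(q²)²`. -/
lemma add_evalNegHom_of_mul_theta {f : ℚ⟦X⟧} (hf : f * theta = expand 2 two_ne_zero theta) :
    f + evalNegHom f = 2 * expand 2 two_ne_zero f ^ 2 := by
  have hn := congrArg evalNegHom hf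
  have h2 := congrArg (expand 2 two_ne_zero) hf
  rw [map_mul, evalNegHom_expand_two] at hn
  rw [map_mul, expand_expand (c := 4) _ _ (by simp) rfl] at h2
  have ht := theta_add_evalNegHom
  have hm := theta_mul_evalNegHom
  apply mul_right_cancel₀ (mul_ne_zero (mul_ne_zero theta_ne_zero
    (evalNegHom_ne_zero theta_ne_zero)) (pow_ne_zero 2 (expand_ne_zero two_ne_zero theta_ne_zero)))
  calc _ = ((f * theta) * evalNegHom theta + (evalNegHom f * evalNegHom theta) * theta) *
        expand 2 two_ne_zero theta ^ 2 := by ring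
    _ = (theta + evalNegHom theta) * expand 2 two_ne_zero theta ^ 3 := by rw [hf, hn]; ring
    _ = 2 * expand 4 four_ne_zero theta *
        (theta * evalNegHom theta * expand 4 four_ne_zero theta) := by rw [ht, hm]
    _ = 2 * (theta * evalNegHom theta) * (expand 2 two_ne_zero f * expand 2 two_ne_zero theta) ^ 2 := by
      rw [h2]; ring
    _ = _ := by ring

/-- The generating function of partitions into parts coprime to `6`. -/
noncomputable def coprimeGen : ℚ⟦X⟧ :=
  mk fun n ↦ ((Nat.Partition.restricted n fun i ↦ ¬ 2 ∣ i ∧ ¬ 3 ∣ i).card : ℚ)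

/-- The generating function of partitions into distinct parts. -/
noncomputable def distinctGen : ℚ⟦X⟧ := mk fun n ↦ ((Nat.Partition.distincts n).card : ℚ)

lemma tendsto_prod_distinctGen :
    Tendsto (fun N ↦ ∏ i ∈ Finset.range N, (1 + X ^ (i + 1) : ℚ⟦X⟧)) atTop (𝓝 distinctGen) := by
  have h := (Nat.Partition.hasProd_powerSeriesMk_card_countRestricted ℚ two_pos).tendsto_prod_nat
  simp_rw [Nat.Partition.countRestricted_two] at h
  refine h.congr fun N ↦ Finset.prod_congr rfl fun i _ ↦ ?_
  exact (Finset.sum_range_succ (fun j ↦ (X : ℚ⟦X⟧) ^ ((i + 1) * j)) 1).trans (by simp)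

lemma distinctGen_mul_euler : distinctGen * euler = expand 2 two_ne_zero euler := by
  refine tendsto_nhds_unique_of_eventuallyEq (tendsto_prod_distinctGen.mul tendsto_eulerProd)
    (tendsto_expand_eulerProd 2 two_ne_zero) (.of_forall fun N ↦ ?_)
  simp only [expand_eulerProd]
  simp only [eulerProd, ← Finset.prod_mul_distrib]
  exact Finset.prod_congr rfl fun i _ ↦ by ring

lemma tendsto_prod_coprimeGen :
    Tendsto (fun N ↦ ∏ i ∈ Finset.range N, (if ¬ 2 ∣ i + 1 ∧ ¬ 3 ∣ i + 1 then
      ∑' j : ℕ, X ^ ((i + 1) * j) else 1 : ℚ⟦X⟧)) atTop (𝓝 coprimeGen) :=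
  (Nat.Partition.hasProd_powerSeriesMk_card_restricted ℚ _).tendsto_prod_nat

lemma tsum_X_pow_mul (i : ℕ) : (∑' j : ℕ, (X : ℚ⟦X⟧) ^ ((i + 1) * j)) * (1 - X ^ (i + 1)) = 1 := by
  simp_rw [pow_mul]
  exact WithPiTopology.tsum_pow_mul_one_sub_of_constantCoeff_eq_zero (by simp)

lemma prod_coprime_mul_eulerProd (N : ℕ) :
    (∏ i ∈ Finset.range (6 * N), (if ¬ 2 ∣ i + 1 ∧ ¬ 3 ∣ i + 1 then
      ∑' j : ℕ, X ^ ((i + 1) * j) else 1 : ℚ⟦X⟧)) * eulerProd (6 * N) *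
        expand 6 (by simp) (eulerProd N) =
      expand 2 two_ne_zero (eulerProd (3 * N)) * expand 3 three_ne_zero (eulerProd (2 * N)) := by
  simp only [expand_eulerProd]
  simp only [eulerProd]
  induction N with
  | zero => simp
  | succ N ih =>
    simp only [show 6 * (N + 1) = 6 * N + 1 + 1 + 1 + 1 + 1 + 1 by ring,
      show 3 * (N + 1) = 3 * N + 1 + 1 + 1 by ring, show 2 * (N + 1) = 2 * N + 1 + 1 by ring,
      Finset.prod_range_succ]
    rw [if_pos (by omega), if_neg (by omega), if_neg (by omega), if_neg (by omega),
      if_pos (by omega), if_neg (by omega)]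
    have h1 := tsum_X_pow_mul (6 * N)
    have h5 := tsum_X_pow_mul (6 * N + 1 + 1 + 1 + 1)
    generalize ∑' j : ℕ, (X : ℚ⟦X⟧) ^ ((6 * N + 1) * j) = s at *
    generalize ∑' j : ℕ, (X : ℚ⟦X⟧) ^ ((6 * N + 1 + 1 + 1 + 1 + 1) * j) = t at *
    generalize (∏ i ∈ Finset.range (6 * N), (if ¬ 2 ∣ i + 1 ∧ ¬ 3 ∣ i + 1 then
      ∑' j : ℕ, X ^ ((i + 1) * j) else 1 : ℚ⟦X⟧)) = p at *
    generalize ∏ i ∈ Finset.range (6 * N), (1 - X ^ (i + 1) : ℚ⟦X⟧) = a at *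
    generalize ∏ i ∈ Finset.range N, (1 - X ^ (6 * (i + 1)) : ℚ⟦X⟧) = b at *
    generalize ∏ i ∈ Finset.range (3 * N), (1 - X ^ (2 * (i + 1)) : ℚ⟦X⟧) = c at *
    generalize ∏ i ∈ Finset.range (2 * N), (1 - X ^ (3 * (i + 1)) : ℚ⟦X⟧) = d at *
    calc _ = (s * (1 - X ^ (6 * N + 1))) * (t * (1 - X ^ (6 * N + 1 + 1 + 1 + 1 + 1))) *
          (p * a * b) * ((1 - X ^ (6 * N + 2)) * (1 - X ^ (6 * N + 3)) * (1 - X ^ (6 * N + 4)) *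
          (1 - X ^ (6 * N + 6)) ^ 2) := by ring
      _ = _ := by rw [h1, h5, ih]; ring

lemma coprimeGen_mul_euler : coprimeGen * euler * expand 6 (by simp) euler =
    expand 2 two_ne_zero euler * expand 3 three_ne_zero euler := by
  have ht (c : ℕ) (hc : c ≠ 0) : Tendsto (fun N : ℕ ↦ c * N) atTop atTop :=
    tendsto_id.const_mul_atTop' (Nat.pos_of_ne_zero hc)
  exact tendsto_nhds_unique_of_eventuallyEq
    (((tendsto_prod_coprimeGen.comp (ht 6 (by simp))).mul
      (tendsto_eulerProd.comp (ht 6 (by simp)))).mul (tendsto_expand_eulerProd 6 (by simp)))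
    (((tendsto_expand_eulerProd 2 two_ne_zero).comp (ht 3 (by simp))).mul
      ((tendsto_expand_eulerProd 3 three_ne_zero).comp (ht 2 (by simp))))
    (.of_forall prod_coprime_mul_eulerProd)

lemma gen_mul_theta :
    coprimeGen * (distinctGen * distinctGen) * theta = expand 2 two_ne_zero theta := by
  have h1 := theta_mul_expand_euler
  have h2 := congrArg (expand 2 two_ne_zero) h1
  rw [map_mul, map_pow, expand_expand (c := 6) _ _ (by simp) rfl] at h2
  apply mul_right_cancel₀ (mul_ne_zero (expand_ne_zero three_ne_zero euler_ne_zero)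
    (expand_ne_zero (c := 6) (by simp) euler_ne_zero))
  calc _ = coprimeGen * distinctGen ^ 2 * expand 6 (by simp) euler *
        (theta * expand 3 three_ne_zero euler) := by ring
    _ = (coprimeGen * euler * expand 6 (by simp) euler) * (distinctGen * euler) ^ 2 := by
      rw [h1]; ring
    _ = expand 2 two_ne_zero euler ^ 3 * expand 3 three_ne_zero euler := by
      rw [coprimeGen_mul_euler, distinctGen_mul_euler]; ring
    _ = _ := by rw [← h2]; ring

/-- Pairs of prescribed total weight are counted by a convolution. -/
lemma card_pair_weight_eq {α β : Type*} (u : α → ℕ) (v : β → ℕ) (n : ℕ)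
    (hu : ∀ i, Finite {a // u a = i}) (hv : ∀ i, Finite {b // v b = i}) :
    Nat.card {p : α × β // u p.1 + v p.2 = n} =
      ∑ p ∈ Finset.HasAntidiagonal.antidiagonal n,
        Nat.card {a // u a = p.1} * Nat.card {b // v b = p.2} := by
  let e : {p : α × β // u p.1 + v p.2 = n} ≃
      Σ p : Finset.HasAntidiagonal.antidiagonal n, {a // u a = p.1.1} × {b // v b = p.1.2} :=
    { toFun := fun p ↦ ⟨⟨(u p.1.1, v p.1.2), Finset.HasAntidiagonal.mem_antidiagonal.2 p.2⟩,
        ⟨p.1.1, rfl⟩, ⟨p.1.2, rfl⟩⟩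
      invFun := fun s ↦ ⟨(s.2.1.1, s.2.2.1), by
        rw [s.2.1.2, s.2.2.2]; exact Finset.HasAntidiagonal.mem_antidiagonal.1 s.1.2⟩
      left_inv := fun _ ↦ rfl
      right_inv := by
        rintro ⟨⟨⟨i, j⟩, h⟩, ⟨a, ha⟩, ⟨b, hb⟩⟩
        dsimp only at ha hb
        subst ha hb
        rfl }
  rw [Nat.card_congr e, Nat.card_sigma]
  simp_rw [Nat.card_prod]
  exact Finset.sum_coe_sort (Finset.HasAntidiagonal.antidiagonal n)
    fun p ↦ Nat.card {a // u a = p.1} * Nat.card {b // v b = p.2}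

lemma finite_pair_weight {α β : Type*} (u : α → ℕ) (v : β → ℕ) (n : ℕ)
    (hu : ∀ i, Finite {a // u a = i}) (hv : ∀ i, Finite {b // v b = i}) :
    Finite {p : α × β // u p.1 + v p.2 = n} := by
  let f (p : {p : α × β // u p.1 + v p.2 = n}) :
      Σ p : Finset.HasAntidiagonal.antidiagonal n, {a // u a = p.1.1} × {b // v b = p.1.2} :=
    ⟨⟨(u p.1.1, v p.1.2), Finset.HasAntidiagonal.mem_antidiagonal.2 p.2⟩,
      ⟨p.1.1, rfl⟩, ⟨p.1.2, rfl⟩⟩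
  refine Finite.of_injective f fun p q h ↦ ?_
  have h1 := congrArg (fun s ↦ (s.2.1.1, s.2.2.1)) h
  exact Subtype.ext h1

/-- Multisets of positive integers satisfying `P`, graded by their sum, as partitions. -/
def subtypeSumEquiv (P : Multiset ℕ → Prop) (n : ℕ) :
    {a : {s : Multiset ℕ // (∀ i ∈ s, 0 < i) ∧ P s} // a.1.sum = n} ≃
      {p : n.Partition // P p.parts} where
  toFun a := ⟨⟨a.1.1, fun h ↦ a.1.2.1 _ h, a.2⟩, a.1.2.2⟩
  invFun p := ⟨⟨p.1.parts, fun _ h ↦ p.1.parts_pos h, p.2⟩, p.1.parts_sum⟩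
  left_inv _ := rfl
  right_inv _ := rfl

lemma card_triple_eq_coeff (n : ℕ) :
    (Nat.card {t : Multiset ℕ × Multiset ℕ × Multiset ℕ //
      (∀ i ∈ t.1, 0 < i ∧ ¬ 2 ∣ i ∧ ¬ 3 ∣ i) ∧
      (∀ i ∈ t.2.1, 0 < i) ∧ t.2.1.Nodup ∧
      (∀ i ∈ t.2.2, 0 < i) ∧ t.2.2.Nodup ∧
      t.1.sum + t.2.1.sum + t.2.2.sum = n} : ℚ) =
    coeff n (coprimeGen * (distinctGen * distinctGen)) := by
  let α := {s : Multiset ℕ // (∀ i ∈ s, 0 < i) ∧ ∀ i ∈ s, ¬ 2 ∣ i ∧ ¬ 3 ∣ i}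
  let β := {s : Multiset ℕ // (∀ i ∈ s, 0 < i) ∧ s.Nodup}
  let u (a : α) := a.1.sum
  let v (b : β) := b.1.sum
  have hu (i : ℕ) : Finite {a // u a = i} := .of_equiv _ (subtypeSumEquiv _ i).symm
  have hv (i : ℕ) : Finite {b // v b = i} := .of_equiv _ (subtypeSumEquiv _ i).symm
  have cu (i : ℕ) : (Nat.card {a // u a = i} : ℚ) = coeff i coprimeGen := by
    rw [Nat.card_congr (subtypeSumEquiv _ i), coprimeGen, coeff_mk, Nat.card_eq_fintype_card,
      Fintype.card_subtype]
    rfl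
  have cv (i : ℕ) : (Nat.card {b // v b = i} : ℚ) = coeff i distinctGen := by
    rw [Nat.card_congr (subtypeSumEquiv _ i), distinctGen, coeff_mk, Nat.card_eq_fintype_card,
      Fintype.card_subtype]
    rfl
  let e : {t : Multiset ℕ × Multiset ℕ × Multiset ℕ //
      (∀ i ∈ t.1, 0 < i ∧ ¬ 2 ∣ i ∧ ¬ 3 ∣ i) ∧
      (∀ i ∈ t.2.1, 0 < i) ∧ t.2.1.Nodup ∧
      (∀ i ∈ t.2.2, 0 < i) ∧ t.2.2.Nodup ∧
      t.1.sum + t.2.1.sum + t.2.2.sum = n} ≃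
      {p : α × β × β // u p.1 + (v p.2.1 + v p.2.2) = n} :=
    { toFun := fun t ↦ ⟨⟨⟨t.1.1, fun i h ↦ (t.2.1 i h).1, fun i h ↦ (t.2.1 i h).2⟩,
        ⟨t.1.2.1, t.2.2.1, t.2.2.2.1⟩, ⟨t.1.2.2, t.2.2.2.2.1, t.2.2.2.2.2.1⟩⟩,
        (add_assoc _ _ _).symm.trans t.2.2.2.2.2.2⟩
      invFun := fun p ↦ ⟨⟨p.1.1.1, p.1.2.1.1, p.1.2.2.1⟩,
        fun i h ↦ ⟨p.1.1.2.1 i h, p.1.1.2.2 i h⟩, p.1.2.1.2.1, p.1.2.1.2.2, p.1.2.2.2.1,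
        p.1.2.2.2.2, (add_assoc _ _ _).trans p.2⟩
      left_inv := fun _ ↦ rfl
      right_inv := fun _ ↦ rfl }
  rw [Nat.card_congr e, card_pair_weight_eq u (fun q : β × β ↦ v q.1 + v q.2) n hu
    fun i ↦ finite_pair_weight v v i hv hv]
  simp_rw [card_pair_weight_eq v v _ hv hv, coeff_mul]
  push_cast
  simp_rw [cu, cv]

end CubicTheta

/-- If `d n` is the number of triples `(λ, μ, ν)` where `λ` is a partition with no part
divisible by `2` and no part divisible by `3`, `μ` and `ν` are partitions into distinct
(positive) parts, and `|λ| + |μ| + |ν| = n` (OEIS A128128), then `d` is `2`-convolutive: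
`d (2n) = ∑_{i=0}^{n} d i * d (n - i)`. -/
theorem A128128_two_convolutive (d : ℕ → ℕ)
    (hd : ∀ n, d n = Nat.card {t : Multiset ℕ × Multiset ℕ × Multiset ℕ //
      (∀ i ∈ t.1, 0 < i ∧ ¬ 2 ∣ i ∧ ¬ 3 ∣ i) ∧
      (∀ i ∈ t.2.1, 0 < i) ∧ t.2.1.Nodup ∧
      (∀ i ∈ t.2.2, 0 < i) ∧ t.2.2.Nodup ∧
      t.1.sum + t.2.1.sum + t.2.2.sum = n}) :
    ∀ n, d (2 * n) = ∑ i ∈ Finset.range (n + 1), d i * d (n - i) := by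
  intro n
  have hc (m : ℕ) := (congrArg (Nat.cast (R := ℚ)) (hd m)).trans
    (CubicTheta.card_triple_eq_coeff m)
  have h := congrArg (PowerSeries.coeff (2 * n))
    (CubicTheta.add_evalNegHom_of_mul_theta CubicTheta.gen_mul_theta)
  rw [map_add, CubicTheta.coeff_evalNegHom, (even_two_mul n).neg_one_pow, ← map_pow,
    two_mul (PowerSeries.expand _ _ _),
    map_add, PowerSeries.coeff_expand_mul, sq, PowerSeries.coeff_mul _ (_ * (_ * _)), ← hc] at h
  simp_rw [← hc] at h
  rw [Finset.Nat.sum_antidiagonal_eq_sum_range_succ fun i j ↦ (d i : ℚ) * d j] at h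
  have h' : (d (2 * n) : ℚ) = ∑ i ∈ Finset.range (n + 1), (d i : ℚ) * d (n - i) := by linarith
  exact_mod_cast h'
end

section
/- Let e(n) denote the number of pairs (μ, λ), where μ is a partition into distinct parts none of which is divisible by 3, λ is a partition with no part divisible by 3, and |μ| + |λ| = n (so e(n) counts overpartitions of n with no part divisible by 3). Then for every natural number n, e(3n) = Σ_{i+j+k=n} e(i) · e(j) · e(k), where the sum is over all triples of nonnegative integers (i, j, k) with i + j + k = n; that is, the sequence (e(n)) is 3-convolutive. -/
open Finset PowerSeries Filter Topology
open scoped PowerSeries.WithPiTopology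

namespace ThreeConvolutive

section Gauss

variable {R : Type*} [CommRing R] (q : R)

/-- The terms of the telescoping sum behind the finite form of Gauss's square identity. -/
def gaussTerm (n s : ℕ) : R :=
  (-1) ^ s * q ^ (s * (n + 1)) * (∏ k ∈ range s, (1 + q ^ k)) * ∏ k ∈ Ico s n, (1 - q ^ (k + 1))

lemma sum_gaussTerm_sub (n m : ℕ) (hm : m ≤ n) :
    ∑ s ∈ range (m + 1), (gaussTerm q (n + 1) s - (1 + q ^ (n + 1)) * gaussTerm q n s) =
      (-1) ^ (m + 1) * q ^ ((m + 1) * (n + 1)) * (∏ k ∈ range (m + 1), (1 + q ^ k)) *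
        ∏ k ∈ Ico m n, (1 - q ^ (k + 1)) := by
  induction m with
  | zero =>
    simp [gaussTerm, prod_range_succ]
    ring
  | succ m ih =>
    rw [sum_range_succ, ih (by omega)]
    simp only [gaussTerm]
    rw [prod_Ico_succ_top (by omega), prod_range_succ _ (m + 1), prod_range_succ _ m,
      prod_eq_prod_Ico_succ_bot (show m < n by omega)]
    ring

/-- A finite form (due to Shanks) of Gauss's identity
`∑ (-1) ^ n * q ^ n ^ 2 = ∏ (1 - q ^ n) / (1 + q ^ n)`. -/
lemma gauss_finite (n : ℕ) :
    (∑ k ∈ range (n + 1), (if k = 0 then 1 else 2 * (-1) ^ k) * q ^ (k ^ 2)) *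
      ∏ k ∈ range n, (1 + q ^ (k + 1)) = ∑ s ∈ range (n + 1), gaussTerm q n s := by
  induction n with
  | zero => simp [gaussTerm]
  | succ n ih =>
    have h := sum_gaussTerm_sub q n n le_rfl
    rw [sum_sub_distrib, ← mul_sum, ← ih, sub_eq_iff_eq_add] at h
    rw [sum_range_succ _ (n + 1), sum_range_succ (gaussTerm q (n + 1)), h]
    simp only [gaussTerm, Ico_self, prod_empty, mul_one]
    rw [prod_range_succ (fun k ↦ 1 + q ^ (k + 1)), prod_range_succ' (fun k ↦ 1 + q ^ k),
      if_neg n.succ_ne_zero]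
    ring

end Gauss

/-- The theta series `∑ (-1) ^ n * X ^ n ^ 2` over all integers `n`. -/
noncomputable def theta : ℂ⟦X⟧ :=
  PowerSeries.mk fun n ↦ if n = 0 then 1 else if IsSquare n then 2 * (-1) ^ n else 0

lemma tendsto_theta :
    Tendsto (fun n ↦ ∑ k ∈ range (n + 1), (if k = 0 then 1 else 2 * (-1) ^ k) *
      (X : ℂ⟦X⟧) ^ (k ^ 2)) atTop (𝓝 theta) := by
  rw [WithPiTopology.tendsto_iff_coeff_tendsto]
  refine fun d ↦ tendsto_atTop_of_eventually_const (i₀ := d) fun n hn ↦ ?_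
  have h (k : ℕ) : (if k = 0 then (1 : ℂ⟦X⟧) else 2 * (-1) ^ k) =
      C (if k = 0 then (1 : ℂ) else 2 * (-1) ^ k) := by
    split_ifs <;> simp [map_ofNat]
  simp only [map_sum, h, coeff_C_mul, coeff_X_pow, theta, coeff_mk]
  by_cases hd : IsSquare d
  · obtain ⟨m, rfl⟩ := hd
    have hm : m ≤ m * m := Nat.le_mul_self m
    rw [sum_eq_single_of_mem m (by simp; omega)]
    · by_cases h0 : m = 0
      · simp [h0]
      · rcases Nat.even_or_odd m with hp | hp <;> simp [h0, pow_two, pow_mul, hp]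
    · intro b _ hb
      rw [if_neg (c := m * m = b ^ 2), mul_zero]
      intro h
      exact hb (Nat.mul_self_inj.1 (by rw [h, pow_two]))
  · rw [sum_eq_zero, if_neg, if_neg hd]
    · rintro rfl
      simp at hd
    · intro k _
      rw [if_neg (c := d = k ^ 2), mul_zero]
      rintro rfl
      exact hd ⟨k, pow_two k⟩

lemma tendsto_sum_gaussTerm :
    Tendsto (fun n ↦ ∑ s ∈ range n, gaussTerm (X : ℂ⟦X⟧) n (s + 1)) atTop (𝓝 0) := by
  rw [WithPiTopology.tendsto_iff_coeff_tendsto]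
  refine fun d ↦ tendsto_atTop_of_eventually_const (i₀ := d) fun n hn ↦ ?_
  rw [map_zero]
  refine X_pow_dvd_iff.1 (dvd_sum fun s _ ↦ ?_) d (Nat.lt_succ_of_le hn)
  refine dvd_mul_of_dvd_left (dvd_mul_of_dvd_left (dvd_mul_of_dvd_right ?_ _) _) _
  exact pow_dvd_pow _ (Nat.le_mul_of_pos_left _ s.succ_pos)

lemma multipliable_one_add (f : ℕ → ℂ⟦X⟧) (hf : ∀ n, X ^ (n + 1) ∣ f n) :
    Multipliable fun n ↦ 1 + f n := by
  apply WithPiTopology.multipliable_one_add_of_tendsto_order_atTop_nhds_top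
  refine ENat.tendsto_nhds_top_iff_natCast_lt.mpr fun n ↦ eventually_atTop.mpr ⟨n, fun m hm ↦ ?_⟩
  have h := (X_pow_dvd_iff.1 (hf m))
  refine lt_of_lt_of_le ?_ (nat_le_order (f m) (m + 1) h)
  exact_mod_cast Nat.lt_succ_of_le hm

/-- The product of `1 + c * X ^ n` over all positive integers `n`. -/
noncomputable def eulerProd (c : ℂ) : ℂ⟦X⟧ := ∏' n, (1 + C c * X ^ (n + 1))

/-- The product of `1 + c * X ^ n` over all positive integers `n` not divisible by `3`. -/
noncomputable def regularProd (c : ℂ) : ℂ⟦X⟧ :=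
  ∏' n, (1 + if 3 ∣ n + 1 then 0 else C c * X ^ (n + 1))

lemma hasProd_eulerProd (c : ℂ) : HasProd (fun n ↦ 1 + C c * X ^ (n + 1)) (eulerProd c) :=
  (multipliable_one_add _ fun _ ↦ dvd_mul_left _ _).hasProd

lemma hasProd_regularProd (c : ℂ) :
    HasProd (fun n ↦ 1 + if 3 ∣ n + 1 then 0 else C c * X ^ (n + 1)) (regularProd c) := by
  refine (multipliable_one_add _ fun n ↦ ?_).hasProd
  split_ifs
  · exact dvd_zero _
  · exact dvd_mul_left _ _

lemma ne_zero_of_hasProd {f : ℕ → ℂ⟦X⟧} {a : ℂ⟦X⟧} (h : HasProd f a)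
    (hf : ∀ n, constantCoeff (f n) = 1) : a ≠ 0 := by
  rintro rfl
  have h1 := h.map _ (WithPiTopology.continuous_constantCoeff ℂ)
  have h2 : HasProd (constantCoeff ∘ f) (1 : ℂ) := by
    rw [show (constantCoeff ∘ f : ℕ → ℂ) = fun _ ↦ 1 from funext hf]
    exact hasProd_one
  simpa using h1.unique h2

lemma eulerProd_ne_zero (c : ℂ) : eulerProd c ≠ 0 :=
  ne_zero_of_hasProd (hasProd_eulerProd c) (by simp)

lemma regularProd_ne_zero (c : ℂ) : regularProd c ≠ 0 :=
  ne_zero_of_hasProd (hasProd_regularProd c) fun n ↦ by split_ifs <;> simp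

/-- Gauss's identity. -/
lemma theta_mul_eulerProd : theta * eulerProd 1 = eulerProd (-1) := by
  have h1 := tendsto_theta.mul (hasProd_eulerProd 1).tendsto_prod_nat
  have h2 := (hasProd_eulerProd (-1)).tendsto_prod_nat.add tendsto_sum_gaussTerm
  rw [add_zero] at h2
  refine tendsto_nhds_unique h1 (h2.congr fun n ↦ ?_)
  simp only [map_one, one_mul, gauss_finite, map_neg, neg_mul, ← sub_eq_add_neg]
  rw [sum_range_succ', add_comm]
  simp [gaussTerm]

lemma continuous_expand : Continuous (expand (R := ℂ) 3 three_ne_zero) := by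
  refine continuous_iff_continuousAt.2 fun f ↦ ?_
  rw [ContinuousAt, WithPiTopology.tendsto_iff_coeff_tendsto]
  intro d
  simp only [coeff_expand]
  split_ifs
  · exact (WithPiTopology.continuous_coeff ℂ _).tendsto f
  · exact tendsto_const_nhds

lemma continuous_rescale (ω : ℂ) : Continuous (rescale ω) := by
  refine continuous_iff_continuousAt.2 fun f ↦ ?_
  rw [ContinuousAt, WithPiTopology.tendsto_iff_coeff_tendsto]
  intro d
  simp only [coeff_rescale]
  exact ((WithPiTopology.continuous_coeff ℂ _).tendsto f).const_mul _

lemma eulerProd_eq (c : ℂ) :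
    eulerProd c = regularProd c * expand 3 three_ne_zero (eulerProd c) := by
  have h := (hasProd_eulerProd c).map _ continuous_expand
  have h3 : HasProd (fun n ↦ 1 + if 3 ∣ n + 1 then C c * X ^ (n + 1) else 0)
      (expand 3 three_ne_zero (eulerProd c)) := by
    have hinj : Function.Injective fun n : ℕ ↦ 3 * n + 2 := fun a b h ↦ by simpa using h
    rw [← hinj.hasProd_iff]
    · convert! h using 1
      ext1 n
      have : 3 ∣ 3 * n + 2 + 1 := ⟨n + 1, by ring⟩
      simp only [Function.comp, if_pos this, map_add, map_one, map_mul, map_pow, expand_C, expand_X,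
        ← pow_mul]
      rw [show 3 * n + 2 + 1 = 3 * (n + 1) by ring]
    · intro n hn
      rw [if_neg, add_zero]
      rintro ⟨m, hm⟩
      exact hn ⟨m - 1, by simp; omega⟩
  refine (hasProd_eulerProd c).unique ?_
  convert! (hasProd_regularProd c).mul h3 using 1
  ext1 n
  split_ifs <;> simp

lemma regularProd_norm {c ω : ℂ} (hc : c ^ 3 = c) (hω : IsPrimitiveRoot ω 3) :
    regularProd c * rescale ω (regularProd c) * rescale (ω ^ 2) (regularProd c) =
      expand 3 three_ne_zero (regularProd c) := by
  have h := hasProd_regularProd c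
  refine ((h.mul (h.map _ (continuous_rescale ω))).mul
    (h.map _ (continuous_rescale (ω ^ 2)))).unique ?_
  convert! h.map _ continuous_expand using 1
  ext1 n
  by_cases hn : 3 ∣ n + 1
  · simp [hn]
  · have hs : 1 + ω ^ (n + 1) + (ω ^ (n + 1)) ^ 2 = 0 := by
      have hp : IsPrimitiveRoot (ω ^ (n + 1)) 3 :=
        hω.pow_of_coprime _ ((Nat.prime_three.coprime_iff_not_dvd.2 hn).symm)
      simpa [sum_range_succ] using hp.geom_sum_eq_zero (by norm_num)
    have hs' : 1 + C (ω ^ (n + 1)) + C (ω ^ (n + 1)) ^ 2 = (0 : ℂ⟦X⟧) := by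
      rw [← map_pow, ← map_one C, ← map_add, ← map_add, hs, map_zero]
    have hc' : (C c : ℂ⟦X⟧) ^ 3 = C c := by rw [← map_pow, hc]
    have hr : rescale ω (C c : ℂ⟦X⟧) = C c := by ext; simp [coeff_C]; aesop
    have hr2 : rescale (ω ^ 2) (C c : ℂ⟦X⟧) = C c := by ext; simp [coeff_C]; aesop
    simp only [hn, if_false, Function.comp, map_add, map_one, map_mul, map_pow, rescale_X, hr, hr2,
      expand_C, expand_X, ← pow_mul, mul_pow]
    rw [map_pow] at hs'
    linear_combination (C c * X ^ (n + 1) + C c ^ 2 * X ^ (2 * (n + 1)) * C ω ^ (n + 1) +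
      C c ^ 3 * X ^ (3 * (n + 1)) * (C ω ^ (n + 1) - 1)) * hs' + X ^ (3 * (n + 1)) * hc'

lemma hasProd_card_distinct :
    HasProd (fun n ↦ 1 + if 3 ∣ n + 1 then 0 else C 1 * X ^ (n + 1))
      (PowerSeries.mk fun n ↦
        (#{p : n.Partition | (∀ i ∈ p.parts, ¬ 3 ∣ i) ∧ p.parts.Nodup} : ℂ)) := by
  convert! Nat.Partition.hasProd_genFun
    (fun i c ↦ if ¬ 3 ∣ i ∧ c ≤ 1 then (1 : ℂ) else 0) using 1
  · ext1 i
    rw [tsum_eq_single 0 fun j hj ↦ by simp [hj]]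
    by_cases h : 3 ∣ i + 1 <;> simp [h]
  · ext n
    simp_rw [Nat.Partition.coeff_genFun, coeff_mk, card_filter, Finsupp.prod, prod_boole]
    push_cast
    refine sum_congr rfl fun p _ ↦ if_congr ?_ rfl rfl
    simp only [Multiset.toFinsupp_support, Multiset.mem_toFinset, Multiset.toFinsupp_apply,
      forall₂_and, Multiset.nodup_iff_count_le_one]
    refine and_congr_right fun _ ↦ forall_congr' fun i ↦ ⟨fun h _ ↦ h, fun h ↦ ?_⟩
    by_cases hi : i ∈ p.parts
    · exact h hi
    · simp [hi]

lemma mk_card_restricted_mul :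
    (PowerSeries.mk fun n ↦ (#(Nat.Partition.restricted n (¬ 3 ∣ ·)) : ℂ)) * regularProd (-1) =
      1 := by
  refine ((Nat.Partition.hasProd_powerSeriesMk_card_restricted ℂ (¬ 3 ∣ ·)).mul
    (hasProd_regularProd (-1))).unique ?_
  convert! hasProd_one using 1
  ext1 n
  by_cases h : 3 ∣ n + 1
  · simp [h]
  · simp only [h, not_false_eq_true, if_true, if_false, pow_mul, map_neg, map_one, neg_mul, one_mul,
      ← sub_eq_add_neg]
    exact WithPiTopology.tsum_pow_mul_one_sub_of_constantCoeff_eq_zero (by simp)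

lemma card_pairs (n : ℕ) :
    Nat.card {p : Multiset ℕ × Multiset ℕ //
      (∀ i ∈ p.1, 0 < i ∧ ¬ 3 ∣ i) ∧ p.1.Nodup ∧
      (∀ i ∈ p.2, 0 < i ∧ ¬ 3 ∣ i) ∧
      p.1.sum + p.2.sum = n} =
    ∑ t ∈ antidiagonal n,
      #{p : t.1.Partition | (∀ i ∈ p.parts, ¬ 3 ∣ i) ∧ p.parts.Nodup} *
      #(Nat.Partition.restricted t.2 (¬ 3 ∣ ·)) := by
  classical
  simp_rw [← card_product]
  rw [← card_sigma, ← card_image_of_injOn (f := fun x ↦ (x.2.1.parts, x.2.2.parts))]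
  · refine Nat.subtype_card _ fun p ↦ ?_
    obtain ⟨μ, ν⟩ := p
    simp only [mem_image, mem_sigma, HasAntidiagonal.mem_antidiagonal, mem_product,
      mem_filter, mem_univ, true_and, Nat.Partition.restricted, Prod.mk.injEq]
    constructor
    · rintro ⟨⟨⟨i, j⟩, p, q⟩, ⟨hij, ⟨hp, hp'⟩, hq⟩, rfl, rfl⟩
      refine ⟨fun i hi ↦ ⟨p.parts_pos hi, hp i hi⟩, hp', fun i hi ↦ ⟨q.parts_pos hi, hq i hi⟩, ?_⟩
      rw [p.parts_sum, q.parts_sum]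
      exact hij
    · rintro ⟨hp, hp', hq, h⟩
      exact ⟨⟨(μ.sum, ν.sum), ⟨μ, fun hi ↦ (hp _ hi).1, rfl⟩, ⟨ν, fun hi ↦ (hq _ hi).1, rfl⟩⟩,
        ⟨h, ⟨fun i hi ↦ (hp i hi).2, hp'⟩, fun i hi ↦ (hq i hi).2⟩, rfl, rfl⟩
  · rintro ⟨⟨i, j⟩, ⟨μ, hμ, hi⟩, ⟨ν, hν, hj⟩⟩ - ⟨⟨i', j'⟩, ⟨μ', hμ', hi'⟩, ⟨ν', hν', hj'⟩⟩ - h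
    dsimp only at hi hj hi' hj'
    subst hi hj hi' hj'
    simp only [Prod.mk.injEq] at h
    obtain ⟨rfl, rfl⟩ := h
    rfl

lemma theta_mul {E : ℂ⟦X⟧} (hE : E * regularProd (-1) = regularProd 1) :
    E * theta = expand 3 three_ne_zero theta := by
  have h := congrArg (expand 3 three_ne_zero) theta_mul_eulerProd
  rw [map_mul] at h
  have h1 := eulerProd_eq 1
  have h2 := eulerProd_eq (-1)
  refine mul_right_cancel₀ (mul_ne_zero (regularProd_ne_zero (-1)) (eulerProd_ne_zero 1)) ?_
  linear_combination theta * eulerProd 1 * hE + regularProd 1 * theta_mul_eulerProd +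
    regularProd 1 * h2 - regularProd 1 * regularProd (-1) * h -
    expand 3 three_ne_zero theta * regularProd (-1) * h1

lemma expand_ne_zero {f : ℂ⟦X⟧} (hf : f ≠ 0) : expand 3 three_ne_zero f ≠ 0 := by
  contrapose! hf
  ext n
  simpa using congrArg (coeff (3 * n)) hf

lemma norm_eq_expand {E : ℂ⟦X⟧} (hE : E * regularProd (-1) = regularProd 1) {ω : ℂ}
    (hω : IsPrimitiveRoot ω 3) :
    E * rescale ω E * rescale (ω ^ 2) E = expand 3 three_ne_zero E := by
  refine mul_right_cancel₀ (expand_ne_zero (regularProd_ne_zero (-1))) ?_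
  rw [← map_mul, hE, ← regularProd_norm (by norm_num) hω, ← regularProd_norm (by norm_num) hω, ← hE]
  simp only [map_mul]
  ring

lemma rescale_expand (f : ℂ⟦X⟧) {ω : ℂ} (hω : ω ^ 3 = 1) :
    rescale ω (expand 3 three_ne_zero f) = expand 3 three_ne_zero f := by
  ext n
  rw [coeff_rescale, coeff_expand]
  split_ifs with h
  · obtain ⟨m, rfl⟩ := h
    simp [pow_mul, hω]
  · simp

/-- The part of `theta` with exponents divisible by `3` is `theta` evaluated at `X ^ 9`, and all
other exponents are congruent to `1` modulo `3`. -/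
lemma rescale_theta_sub {ω : ℂ} (hω : ω ^ 3 = 1) :
    rescale ω (expand 3 three_ne_zero (expand 3 three_ne_zero theta) - theta) =
      C ω * (expand 3 three_ne_zero (expand 3 three_ne_zero theta) - theta) := by
  ext n
  rw [coeff_rescale, coeff_C_mul]
  by_cases h1 : n % 3 = 1
  · rw [← Nat.div_add_mod n 3, h1, pow_add, pow_mul, hω]
    simp
  suffices h : coeff n (expand 3 three_ne_zero (expand 3 three_ne_zero theta) - theta) = 0 by
    rw [h, mul_zero, mul_zero]
  rw [map_sub, sub_eq_zero]
  by_cases hs : IsSquare n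
  · obtain ⟨m, rfl⟩ := hs
    have hm : 3 ∣ m := by
      by_contra hm
      have : m % 3 = 1 ∨ m % 3 = 2 := by omega
      rcases this with h | h <;> simp [Nat.mul_mod, h] at h1
    obtain ⟨k, rfl⟩ := hm
    rw [show 3 * k * (3 * k) = 3 * (3 * (k * k)) by ring, coeff_expand_mul, coeff_expand_mul]
    simp only [theta, coeff_mk]
    by_cases hk : k = 0
    · simp [hk]
    · have h9 : IsSquare (3 * (3 * (k * k))) := ⟨3 * k, by ring⟩
      have h1 : k * k ≠ 0 := by simpa
      rw [if_neg h1, if_pos ⟨k, rfl⟩, if_neg (by omega), if_pos h9,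
        pow_mul (-1 : ℂ) 3 (3 * (k * k)), pow_mul _ 3 (k * k)]
      norm_num
  · have hn : n ≠ 0 := by rintro rfl; simp at hs
    rw [show coeff n theta = 0 by simp [theta, hs, hn]]
    by_cases h9 : 3 ∣ n
    · obtain ⟨m, rfl⟩ := h9
      rw [coeff_expand_mul]
      by_cases h9 : 3 ∣ m
      · obtain ⟨m, rfl⟩ := h9
        have hm : ¬ IsSquare m := by
          rintro ⟨k, rfl⟩
          exact hs ⟨3 * k, by ring⟩
        rw [coeff_expand_mul]
        have hm0 : m ≠ 0 := by rintro rfl; simp at hn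
        simp [theta, hm, hm0]
      · exact coeff_expand_of_not_dvd _ _ _ h9
    · exact coeff_expand_of_not_dvd _ _ _ h9

lemma theta_ne_zero : theta ≠ 0 := by
  intro h
  simpa [theta] using congrArg (coeff 0) h

lemma sum_rescale_eq {E : ℂ⟦X⟧} (hE : E * regularProd (-1) = regularProd 1) {ω : ℂ}
    (hω : IsPrimitiveRoot ω 3) :
    E + rescale ω E + rescale (ω ^ 2) E = 3 * expand 3 three_ne_zero E ^ 3 := by
  have hω3 : ω ^ 3 = 1 := hω.pow_eq_one
  have hω6 : (ω ^ 2) ^ 3 = 1 := by rw [← pow_mul, mul_comm, pow_mul, hω3, one_pow]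
  have hsum : (1 + C ω + C ω ^ 2 : ℂ⟦X⟧) = 0 := by
    have h : 1 + ω + ω ^ 2 = 0 := by
      simpa [sum_range_succ] using hω.geom_sum_eq_zero (by norm_num)
    rw [← map_pow, ← map_one C, ← map_add, ← map_add, h, map_zero]
  have h := theta_mul hE
  have hN := norm_eq_expand hE hω
  have ha := congrArg (expand 3 three_ne_zero) h
  rw [map_mul] at ha
  set T := expand 3 three_ne_zero theta with hT
  set a := expand 3 three_ne_zero T with ha'
  obtain ⟨b, hb⟩ : ∃ b, b = a - theta := ⟨_, rfl⟩
  have hab : theta = a - b := by rw [hb]; ring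
  have h1 : rescale ω E * (a - C ω * b) = T := by
    have hr := rescale_theta_sub hω3
    rw [map_sub, rescale_expand _ hω3, ← hT, ← ha'] at hr
    rw [hb, ← hr, sub_sub_cancel, ← map_mul, h, hT, rescale_expand _ hω3]
  have h2 : rescale (ω ^ 2) E * (a - C ω ^ 2 * b) = T := by
    have hr := rescale_theta_sub hω6
    rw [map_sub, rescale_expand _ hω6, ← hT, ← ha'] at hr
    rw [hb, ← map_pow, ← hr, sub_sub_cancel, ← map_mul, h, hT, rescale_expand _ hω6]
  rw [hab] at h
  have hT0 : T ≠ 0 := expand_ne_zero theta_ne_zero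
  generalize rescale ω E = E₁ at *
  generalize rescale (ω ^ 2) E = E₂ at *
  generalize expand 3 three_ne_zero E = E₃ at *
  generalize (C ω : ℂ⟦X⟧) = w at *
  clear_value T a
  have key0 : E * T ^ 2 = E₃ * ((a - w * b) * (a - w ^ 2 * b)) := by
    rw [← hN, pow_two]; nth_rw 1 [← h1]; rw [← h2]; ring
  have key1 : E₁ * T ^ 2 = E₃ * ((a - b) * (a - w ^ 2 * b)) := by
    rw [← hN, pow_two]; nth_rw 1 [← h]; rw [← h2]; ring
  have key2 : E₂ * T ^ 2 = E₃ * ((a - b) * (a - w * b)) := by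
    rw [← hN, pow_two]; nth_rw 1 [← h]; rw [← h1]; ring
  refine mul_right_cancel₀ (pow_ne_zero 2 hT0) ?_
  have hd : (a - w * b) * (a - w ^ 2 * b) + (a - b) * (a - w ^ 2 * b) + (a - b) * (a - w * b) =
      3 * a ^ 2 := by
    linear_combination (-2 * a * b + b ^ 2 * w) * hsum
  linear_combination key0 + key1 + key2 + E₃ * hd - 3 * E₃ * (a + E₃ * T) * ha

lemma sum_antidiagonalTuple_three (f : ℕ → ℕ) (n : ℕ) :
    ((∑ t ∈ Finset.Nat.antidiagonalTuple 3 n, f (t 0) * f (t 1) * f (t 2) : ℕ) : ℂ) =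
      coeff n ((PowerSeries.mk fun n ↦ (f n : ℂ)) ^ 3) := by
  rw [pow_succ', pow_two, coeff_mul]
  simp_rw [coeff_mul, coeff_mk, mul_sum, sum_sigma']
  push_cast
  refine sum_bij' (fun t _ ↦ ⟨(t 0, t 1 + t 2), (t 1, t 2)⟩) (fun x _ ↦ ![x.1.1, x.2.1, x.2.2])
    ?_ ?_ ?_ ?_ ?_
  · intro t ht
    simpa [Finset.Nat.mem_antidiagonalTuple, Fin.sum_univ_three, add_assoc] using ht
  · rintro ⟨⟨i, m⟩, ⟨j, k⟩⟩ h
    simp only [mem_sigma, HasAntidiagonal.mem_antidiagonal] at h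
    simp [Finset.Nat.mem_antidiagonalTuple, Fin.sum_univ_three, add_assoc, h]
  · intro t _
    ext i
    fin_cases i <;> rfl
  · rintro ⟨⟨i, m⟩, ⟨j, k⟩⟩ h
    simp only [mem_sigma, HasAntidiagonal.mem_antidiagonal] at h
    obtain ⟨-, rfl⟩ := h
    rfl
  · intro t _
    ring

end ThreeConvolutive

open ThreeConvolutive in
/-- If `e n` is the number of pairs `(μ, λ)` where `μ` is a partition into distinct parts
none divisible by `3`, `λ` is a partition with no part divisible by `3`, and
`|μ| + |λ| = n` (overpartitions of `n` with no part divisible by `3`, OEIS A098151), then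
`e` is `3`-convolutive: `e (3n) = ∑_{i+j+k=n} e i * e j * e k`. -/
theorem A098151_three_convolutive (e : ℕ → ℕ)
    (he : ∀ n, e n = Nat.card {p : Multiset ℕ × Multiset ℕ //
      (∀ i ∈ p.1, 0 < i ∧ ¬ 3 ∣ i) ∧ p.1.Nodup ∧
      (∀ i ∈ p.2, 0 < i ∧ ¬ 3 ∣ i) ∧
      p.1.sum + p.2.sum = n}) :
    ∀ n, e (3 * n) =
      ∑ t ∈ Finset.Nat.antidiagonalTuple 3 n, e (t 0) * e (t 1) * e (t 2) := by
  intro n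
  have hω := Complex.isPrimitiveRoot_exp 3 three_ne_zero
  set ω := Complex.exp (2 * Real.pi * Complex.I / (3 : ℕ))
  have hE : (PowerSeries.mk fun n ↦ (e n : ℂ)) * regularProd (-1) = regularProd 1 := by
    have h : (PowerSeries.mk fun n ↦ (e n : ℂ)) = regularProd 1 *
        PowerSeries.mk fun n ↦ (#(Nat.Partition.restricted n (¬ 3 ∣ ·)) : ℂ) := by
      ext n
      rw [(hasProd_regularProd 1).unique hasProd_card_distinct, coeff_mul, coeff_mk, he, card_pairs]
      simp
    rw [h, mul_assoc, mk_card_restricted_mul, mul_one]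
  have h := congrArg (coeff (3 * n)) (sum_rescale_eq hE hω)
  rw [← map_pow, ← map_ofNat C 3, coeff_C_mul, coeff_expand_mul, ← sum_antidiagonalTuple_three,
    map_add, map_add, coeff_rescale, coeff_rescale, coeff_mk, ← pow_mul, pow_mul ω 3, hω.pow_eq_one,
    mul_left_comm 2, pow_mul ω 3, hω.pow_eq_one] at h
  have h' : (e (3 * n) : ℂ) =
      (∑ t ∈ Finset.Nat.antidiagonalTuple 3 n, e (t 0) * e (t 1) * e (t 2) : ℕ) := by
    simp only [one_pow, one_mul] at h
    linear_combination h / 3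
  exact_mod_cast h'
end

section
/- Let g(n) denote the number of partitions of n in which every even part size occurs at most twice and every odd part size occurs exactly once, exactly three times, or exactly four times (if it occurs at all). Then for every natural number n, g(3n) = Σ_{i+j+k=n} g(i) · g(j) · g(k), where the sum is over all triples of nonnegative integers (i, j, k) with i + j + k = n; that is, the sequence (g(n)) is 3-convolutive. -/
open PowerSeries Filter Topology
open scoped PowerSeries.WithPiTopology

section TripleProduct

variable {K : Type*} [Field K]

/-- `1 / (Q; Q)_m`, extended by zero to negative `m`. -/
noncomputable def invPochhammer (Q : K⟦X⟧) (m : ℤ) : K⟦X⟧ :=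
  if m < 0 then 0 else ∏ i ∈ Finset.range m.toNat, (1 - Q ^ (i + 1))⁻¹

lemma one_sub_pow_mul_inv {Q : K⟦X⟧} (hQ : constantCoeff Q = 0) (n : ℕ) :
    (1 - Q ^ (n + 1)) * (1 - Q ^ (n + 1))⁻¹ = 1 :=
  PowerSeries.mul_inv_cancel _ (by simp [hQ])

lemma invPochhammer_of_neg (Q : K⟦X⟧) {m : ℤ} (hm : m < 0) : invPochhammer Q m = 0 := if_pos hm

lemma invPochhammer_natCast (Q : K⟦X⟧) (m : ℕ) :
    invPochhammer Q m = ∏ i ∈ Finset.range m, (1 - Q ^ (i + 1))⁻¹ := by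
  simp [invPochhammer]

lemma invPochhammer_sub_one {Q : K⟦X⟧} (hQ : constantCoeff Q = 0) (m : ℕ) :
    invPochhammer Q (m - 1) = (1 - Q ^ m) * invPochhammer Q m := by
  rcases m with _ | m
  · simp [invPochhammer]
  · rw [show ((m + 1 : ℕ) : ℤ) - 1 = (m : ℕ) by push_cast; ring, invPochhammer_natCast,
      invPochhammer_natCast, Finset.prod_range_succ]
    linear_combination -(∏ i ∈ Finset.range m, (1 - Q ^ (i + 1))⁻¹) * one_sub_pow_mul_inv hQ m

/-- The Gaussian binomial coefficient `[2n, n + k]_Q`. -/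
noncomputable def centralQBinomial (Q : K⟦X⟧) (n : ℕ) (k : ℤ) : K⟦X⟧ :=
  (∏ i ∈ Finset.range (2 * n), (1 - Q ^ (i + 1))) *
    (invPochhammer Q (n - k) * invPochhammer Q (n + k))

lemma centralQBinomial_eq_zero (Q : K⟦X⟧) {n : ℕ} {k : ℤ} (h : n - k < 0 ∨ n + k < 0) :
    centralQBinomial Q n k = 0 := by
  rcases h with h | h <;> simp [centralQBinomial, invPochhammer_of_neg _ h]

lemma centralQBinomial_succ {Q : K⟦X⟧} (hQ : constantCoeff Q = 0) {n u v : ℕ} {k : ℤ}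
    (hu : (u : ℤ) = n + 1 - k) (hv : (v : ℤ) = n + 1 + k) :
    centralQBinomial Q (n + 1) k = (1 + Q ^ (2 * n + 1)) * centralQBinomial Q n k +
      Q ^ u * centralQBinomial Q n (k - 1) + Q ^ v * centralQBinomial Q n (k + 1) := by
  have huv : u + v = 2 * n + 2 := by omega
  simp only [centralQBinomial]
  rw [show 2 * (n + 1) = 2 * n + 1 + 1 by ring, Finset.prod_range_succ, Finset.prod_range_succ,
    show ((n + 1 : ℕ) : ℤ) - k = u by push_cast; linarith,
    show ((n + 1 : ℕ) : ℤ) + k = v by push_cast; linarith,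
    show (n : ℤ) - k = u - 1 by linarith, show (n : ℤ) + k = v - 1 by linarith,
    show (n : ℤ) - (k - 1) = u by linarith, show (n : ℤ) + (k - 1) = v - 1 - 1 by linarith,
    show (n : ℤ) - (k + 1) = u - 1 - 1 by linarith, show (n : ℤ) + (k + 1) = v by linarith]
  rcases u with _ | u
  · obtain rfl : v = 2 * n + 2 := by omega
    have h1 := invPochhammer_sub_one hQ (2 * n + 2)
    have h2 := invPochhammer_sub_one hQ (2 * n + 1)
    rw [show ((2 * n + 2 : ℕ) : ℤ) - 1 = (2 * n + 1 : ℕ) by push_cast; ring] at *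
    rw [h2, h1]
    simp [invPochhammer]
    ring_nf
  rcases v with _ | v
  · obtain rfl : u = 2 * n + 1 := by omega
    have h1 := invPochhammer_sub_one hQ (2 * n + 2)
    have h2 := invPochhammer_sub_one hQ (2 * n + 1)
    rw [show ((2 * n + 1 + 1 : ℕ) : ℤ) - 1 = (2 * n + 1 : ℕ) by push_cast; ring] at *
    rw [h2, h1]
    simp [invPochhammer]
    ring_nf
  have hu1 := invPochhammer_sub_one hQ (u + 1)
  have hu2 := invPochhammer_sub_one hQ u
  have hv1 := invPochhammer_sub_one hQ (v + 1)
  have hv2 := invPochhammer_sub_one hQ v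
  rw [show ((u + 1 : ℕ) : ℤ) - 1 = (u : ℕ) by push_cast; ring] at *
  rw [show ((v + 1 : ℕ) : ℤ) - 1 = (v : ℕ) by push_cast; ring] at *
  obtain huv' : 2 * n = u + v := by omega
  rw [hu2, hv2, hu1, hv1, huv']
  ring

/-- The exponent of the `k`-th term of Ramanujan's theta function `f(X ^ a, X ^ b)`. -/
def thetaExp (a b : ℕ) (k : ℤ) : ℕ := (a * (k * (k + 1) / 2) + b * (k * (k - 1) / 2)).toNat

lemma exists_mul_add_one_eq (k : ℤ) :
    ∃ T : ℤ, 0 ≤ T ∧ T + k ≥ 0 ∧ k * (k - 1) / 2 = T ∧ k * (k + 1) / 2 = T + k ∧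
      k * (k - 1) = 2 * T := by
  obtain ⟨T, hT⟩ : (2 : ℤ) ∣ k * (k - 1) := by
    have := Int.even_mul_pred_self k
    exact this.two_dvd
  have h2 : k * (k + 1) = 2 * (T + k) := by linarith
  refine ⟨T, ?_, ?_, by omega, by omega, hT⟩
  · rcases le_or_gt k 0 with h | h <;> nlinarith
  · rcases lt_or_ge k 0 with h | h <;> nlinarith

lemma thetaExp_cast (a b : ℕ) (k : ℤ) :
    (2 * thetaExp a b k : ℤ) = a * (k * (k + 1)) + b * (k * (k - 1)) := by
  obtain ⟨T, h0, h1, h2, h3, h4⟩ := exists_mul_add_one_eq k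
  rw [thetaExp, h2, h3, Int.toNat_of_nonneg (by positivity)]
  linear_combination (-a - b : ℤ) * h4

lemma thetaExp_sub_one {a b n u : ℕ} {k : ℤ} (hu : (u : ℤ) = n + 1 - k) :
    a + (a + b) * n + thetaExp a b (k - 1) = (a + b) * u + thetaExp a b k := by
  have h1 := thetaExp_cast a b k
  have h2 := thetaExp_cast a b (k - 1)
  zify
  rw [hu]
  linarith

lemma thetaExp_add_one {a b n v : ℕ} {k : ℤ} (hv : (v : ℤ) = n + 1 + k) :
    b + (a + b) * n + thetaExp a b (k + 1) = (a + b) * v + thetaExp a b k := by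
  have h1 := thetaExp_cast a b k
  have h2 := thetaExp_cast a b (k + 1)
  zify
  rw [hv]
  linarith

lemma centralQBinomial_succ_mul_X_pow_thetaExp {a b : ℕ} (hab : 0 < a + b) (n : ℕ) (k : ℤ) :
    centralQBinomial (X ^ (a + b) : K⟦X⟧) (n + 1) k * X ^ thetaExp a b k =
      (1 + X ^ ((a + b) * (2 * n + 1))) *
        (centralQBinomial (X ^ (a + b)) n k * X ^ thetaExp a b k) +
      X ^ (a + (a + b) * n) *
        (centralQBinomial (X ^ (a + b)) n (k - 1) * X ^ thetaExp a b (k - 1)) +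
      X ^ (b + (a + b) * n) *
        (centralQBinomial (X ^ (a + b)) n (k + 1) * X ^ thetaExp a b (k + 1)) := by
  by_cases h : (n : ℤ) + 1 - k < 0 ∨ (n : ℤ) + 1 + k < 0
  · rw [centralQBinomial_eq_zero, centralQBinomial_eq_zero, centralQBinomial_eq_zero,
      centralQBinomial_eq_zero]
    · simp
    all_goals omega
  rw [not_or, not_lt, not_lt] at h
  obtain ⟨u, hu⟩ := Int.eq_ofNat_of_zero_le h.1
  obtain ⟨v, hv⟩ := Int.eq_ofNat_of_zero_le h.2
  have hQ : constantCoeff (X ^ (a + b) : K⟦X⟧) = 0 := by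
    rw [map_pow, constantCoeff_X, zero_pow hab.ne']
  have h1 := congrArg (fun e ↦ (X : K⟦X⟧) ^ e) (thetaExp_sub_one (a := a) (b := b) hu.symm)
  have h2 := congrArg (fun e ↦ (X : K⟦X⟧) ^ e) (thetaExp_add_one (a := a) (b := b) hv.symm)
  rw [centralQBinomial_succ hQ hu.symm hv.symm]
  simp only [pow_add _ (_ + _), pow_add _ (_ * _), pow_add _ a ((a + b) * _),
    pow_add _ b ((a + b) * _), pow_mul] at h1 h2 ⊢
  generalize (X : K⟦X⟧) ^ (a + b) = Q at *
  linear_combination -centralQBinomial Q n (k - 1) * h1 - centralQBinomial Q n (k + 1) * h2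

lemma tendsto_order_X_pow_mul {a s : ℕ} (hs : 0 < s) (g : ℕ → K⟦X⟧) :
    Tendsto (fun n ↦ (X ^ (a + s * n) * g n).order) atTop (𝓝 ⊤) := by
  refine ENat.tendsto_nhds_top_iff_natCast_lt.mpr fun n ↦ eventually_atTop.mpr ⟨n + 1, ?_⟩
  intro m hm
  grw [← le_order_mul, order_X_pow]
  refine lt_add_of_lt_of_nonneg ?_ (by simp)
  norm_cast
  nlinarith

variable [TopologicalSpace K]

lemma hasSum_centralQBinomial_mul_X_pow_thetaExp [IsTopologicalRing K]
    {a b : ℕ} (hab : 0 < a + b) (n : ℕ) :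
    HasSum (fun k ↦ centralQBinomial (X ^ (a + b) : K⟦X⟧) n k * X ^ thetaExp a b k)
      (∏ i ∈ Finset.range n, ((1 + X ^ (a + (a + b) * i)) * (1 + X ^ (b + (a + b) * i)))) := by
  induction n with
  | zero =>
    have h := hasSum_single (L := .unconditional ℤ)
      (f := fun k ↦ centralQBinomial (X ^ (a + b) : K⟦X⟧) 0 k * X ^ thetaExp a b k) 0 fun k hk ↦ by
        rw [centralQBinomial_eq_zero _ (by omega), zero_mul]
    simpa [centralQBinomial, invPochhammer, thetaExp] using h
  | succ n ih =>
    have h := ((ih.mul_left (1 + X ^ ((a + b) * (2 * n + 1)))).add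
      (((Equiv.subRight (1 : ℤ)).hasSum_iff.2 ih).mul_left (X ^ (a + (a + b) * n)))).add
      (((Equiv.addRight (1 : ℤ)).hasSum_iff.2 ih).mul_left (X ^ (b + (a + b) * n)))
    convert! h using 1
    · ext1 k
      exact centralQBinomial_succ_mul_X_pow_thetaExp hab n k
    · rw [Finset.prod_range_succ]
      ring

lemma multipliable_one_add_X_pow_mul (a : ℕ) {s : ℕ} (hs : 0 < s) (g : ℕ → K⟦X⟧) :
    Multipliable fun n ↦ 1 + X ^ (a + s * n) * g n :=
  WithPiTopology.multipliable_one_add_of_tendsto_order_atTop_nhds_top K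
    (tendsto_order_X_pow_mul hs g)

/-- The infinite product `∏ (1 + ε X ^ (a + s n))` over `n ≥ 0`. -/
noncomputable def qProd (ε : K) (a s : ℕ) : K⟦X⟧ := ∏' n, (1 + C ε * X ^ (a + s * n))

lemma hasProd_qProd (ε : K) (a : ℕ) {s : ℕ} (hs : 0 < s) :
    HasProd (fun n ↦ 1 + C ε * X ^ (a + s * n)) (qProd ε a s) := by
  have := multipliable_one_add_X_pow_mul a hs fun _ ↦ C ε
  simp only [mul_comm _ (C ε)] at this
  exact this.hasProd

lemma tendsto_centralQBinomial [IsTopologicalRing K] [T2Space K] {s : ℕ} (hs : 0 < s) :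
    ∃ L : K⟦X⟧, L * qProd (-1) s s = 1 ∧
      ∀ k, Tendsto (fun n ↦ centralQBinomial (X ^ s) n k) atTop (𝓝 L) := by
  have hQ : constantCoeff (X ^ s : K⟦X⟧) = 0 := by simp [hs.ne']
  have hinv (n : ℕ) := one_sub_pow_mul_inv hQ n
  have h1 : HasProd (fun n ↦ (1 - (X ^ s : K⟦X⟧) ^ (n + 1))) (qProd (-1) s s) := by
    convert! hasProd_qProd (-1 : K) s hs using 2 with n
    rw [← pow_mul]
    simp
    ring_nf
  have h2 : Multipliable (fun n ↦ (1 - (X ^ s : K⟦X⟧) ^ (n + 1))⁻¹) := by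
    convert! multipliable_one_add_X_pow_mul s hs fun n ↦ (1 - (X ^ s : K⟦X⟧) ^ (n + 1))⁻¹
      using 2 with n
    rw [show s + s * n = s * (n + 1) by ring, pow_mul]
    linear_combination hinv n
  obtain ⟨r, h2⟩ := h2
  have h3 : r * qProd (-1) s s = 1 := by
    have := h2.mul h1
    simp only [mul_comm _⁻¹, hinv] at this
    exact this.unique hasProd_one
  have hlim (f : ℕ → ℤ) (hf : Tendsto f atTop atTop) :
      Tendsto (fun n ↦ invPochhammer (X ^ s : K⟦X⟧) (f n)) atTop (𝓝 r) := by
    have := h2.tendsto_prod_nat.comp ((tendsto_atTop_atTop.2 fun b ↦ ⟨b, fun a h ↦ by omega⟩ :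
      Tendsto Int.toNat atTop atTop).comp hf)
    refine this.congr' ?_
    filter_upwards [hf.eventually_ge_atTop 0] with n hn
    simp [invPochhammer, not_lt.2 hn]
  refine ⟨qProd (-1) s s * (r * r), by linear_combination (r * qProd (-1) s s + 1) * h3,
    fun k ↦ ?_⟩
  refine Tendsto.mul (h1.tendsto_prod_nat.comp
    (tendsto_id.const_mul_atTop' two_pos)) (Tendsto.mul (hlim _ ?_) (hlim _ ?_))
  · exact tendsto_atTop_add_const_right _ _ tendsto_natCast_atTop_atTop
  · exact tendsto_atTop_add_const_right _ _ tendsto_natCast_atTop_atTop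

lemma natAbs_le_thetaExp_add_one {a b : ℕ} (hab : 0 < a + b) (k : ℤ) :
    k.natAbs ≤ thetaExp a b k + 1 := by
  have h1 := thetaExp_cast a b k
  obtain ⟨T, h2, h3, -, -, h6⟩ := exists_mul_add_one_eq k
  have : T ≤ thetaExp a b k ∨ T + k ≤ thetaExp a b k := by
    rcases Nat.eq_zero_or_pos a with rfl | ha
    · left; nlinarith
    · right; nlinarith
  have : (k.natAbs : ℤ) ≤ thetaExp a b k + 1 := by
    rw [Int.natCast_natAbs]
    rcases abs_cases k with ⟨h, _⟩ | ⟨h, _⟩ <;> rw [h] <;> rcases this with h' | h' <;>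
      nlinarith [sq_nonneg (k - 1), sq_nonneg (k + 1), sq_nonneg k]
  exact_mod_cast this

/-- The Jacobi triple product identity, in Ramanujan's form. -/
theorem hasSum_X_pow_thetaExp [IsTopologicalRing K] [T2Space K] {a b : ℕ} (hab : 0 < a + b) :
    HasSum (fun k ↦ (X : K⟦X⟧) ^ thetaExp a b k)
      (qProd 1 a (a + b) * qProd 1 b (a + b) * qProd (-1) (a + b) (a + b)) := by
  obtain ⟨L, hL, hlim⟩ := tendsto_centralQBinomial (K := K) hab
  suffices h : HasSum (fun k ↦ L * (X : K⟦X⟧) ^ thetaExp a b k)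
      (qProd 1 a (a + b) * qProd 1 b (a + b)) by
    convert! h.mul_left (qProd (-1) (a + b) (a + b)) using 1
    · ext1 k
      linear_combination -X ^ thetaExp a b k * hL
    · ring
  rw [WithPiTopology.hasSum_iff_hasSum_coeff]
  intro d
  have hsupp (g : K⟦X⟧) (k : ℤ) (hk : k ∉ Finset.Icc (-(d + 1 : ℤ)) (d + 1)) :
      coeff d (g * X ^ thetaExp a b k) = 0 := by
    have := natAbs_le_thetaExp_add_one hab k
    rw [coeff_mul_X_pow', if_neg]
    rw [Finset.mem_Icc] at hk
    omega
  convert! hasSum_sum_of_ne_finset_zero (L := .unconditional ℤ) (hsupp L) using 1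
  have hF := ((hasProd_qProd (1 : K) a hab).mul (hasProd_qProd 1 b hab)).tendsto_prod_nat
  simp only [map_one, one_mul] at hF
  refine tendsto_nhds_unique (((WithPiTopology.continuous_coeff K d).tendsto _).comp hF) ?_
  have : Tendsto (fun n ↦ ∑ k ∈ Finset.Icc (-(d + 1 : ℤ)) (d + 1),
      coeff d (centralQBinomial (X ^ (a + b)) n k * (X : K⟦X⟧) ^ thetaExp a b k)) atTop
      (𝓝 (∑ k ∈ Finset.Icc (-(d + 1 : ℤ)) (d + 1), coeff d (L * X ^ thetaExp a b k))) :=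
    tendsto_finsetSum _ fun k _ ↦ ((WithPiTopology.continuous_coeff K d).tendsto _).comp
      ((hlim k).mul_const _)
  refine this.congr fun n ↦ ?_
  exact (hasSum_sum_of_ne_finset_zero fun k hk ↦ hsupp _ k hk).unique
    ((WithPiTopology.hasSum_iff_hasSum_coeff _).1
      (hasSum_centralQBinomial_mul_X_pow_thetaExp hab n) d)

end TripleProduct

section Products

variable {K : Type*} [Field K]

lemma rescale_expand {p : ℕ} (hp : p ≠ 0) {c : K} (hc : c ^ p = 1) (φ : K⟦X⟧) :
    rescale c (expand p hp φ) = expand p hp φ := by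
  ext n
  rw [coeff_rescale, coeff_expand]
  split_ifs with h
  · obtain ⟨m, rfl⟩ := h
    rw [pow_mul, hc, one_pow, one_mul]
  · rw [mul_zero]

variable [TopologicalSpace K]

lemma continuous_expand {p : ℕ} (hp : p ≠ 0) :
    Continuous (expand p hp : K⟦X⟧ → K⟦X⟧) := by
  refine continuous_iff_continuousAt.2 fun φ ↦
    (WithPiTopology.tendsto_iff_coeff_tendsto _ _ _ _).2 fun d ↦ ?_
  simp only [coeff_expand]
  split_ifs
  · exact (WithPiTopology.continuous_coeff K _).tendsto _
  · exact tendsto_const_nhds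

lemma continuous_rescale [IsTopologicalRing K] (c : K) :
    Continuous (rescale c : K⟦X⟧ → K⟦X⟧) := by
  refine continuous_iff_continuousAt.2 fun φ ↦
    (WithPiTopology.tendsto_iff_coeff_tendsto _ _ _ _).2 fun d ↦ ?_
  simp only [coeff_rescale]
  exact ((WithPiTopology.continuous_coeff K d).tendsto _).const_mul _

lemma hasProd_ite_mod_eq (ε : K) (a : ℕ) {s m j : ℕ} (hs : 0 < s) (hj : j < m) :
    HasProd (fun n ↦ if n % m = j then 1 + C ε * X ^ (a + s * n) else 1)
      (qProd ε (a + s * j) (m * s)) := by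
  have hm : 0 < m := by omega
  have hinj : Function.Injective fun n ↦ m * n + j := fun x y h ↦ by
    simpa [hm.ne'] using h
  rw [← hinj.hasProd_iff]
  · convert! hasProd_qProd ε (a + s * j) (s := m * s) (by positivity) using 2 with n
    rw [Function.comp_apply, if_pos (by rw [Nat.mul_add_mod, Nat.mod_eq_of_lt hj])]
    ring_nf
  · intro n hn
    refine if_neg fun h ↦ hn ⟨n / m, ?_⟩
    rw [← h]
    exact Nat.div_add_mod n m

/-- The Euler product `∏ (1 - X ^ (k n))` over `n ≥ 1`. -/
noncomputable abbrev eulerProd (K : Type*) [Field K] [TopologicalSpace K] (k : ℕ) : K⟦X⟧ :=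
  qProd (-1) k k

lemma hasProd_eulerProd {k : ℕ} (hk : 0 < k) :
    HasProd (fun n ↦ 1 - X ^ (k * (n + 1))) (eulerProd K k) := by
  convert! hasProd_qProd (-1 : K) k hk using 2 with n
  rw [map_neg, map_one]
  ring_nf

lemma hasProd_eulerProd_mul {k m : ℕ} (hk : 0 < k) (hm : 0 < m) :
    HasProd (fun n ↦ if m ∣ n + 1 then 1 - X ^ (k * (n + 1)) else 1) (eulerProd K (m * k)) := by
  have h := hasProd_ite_mod_eq (-1 : K) k (m := m) (j := m - 1) hk (by omega)
  rw [show k + k * (m - 1) = m * k by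
    obtain ⟨m, rfl⟩ := Nat.exists_eq_add_of_lt hm; simp; ring] at h
  convert! h using 2 with n
  refine if_congr ?_ ?_ rfl
  · obtain ⟨m, rfl⟩ := Nat.exists_eq_add_of_lt hm
    simp only [zero_add, Nat.add_sub_cancel]
    constructor
    · rintro ⟨c, hc⟩
      obtain ⟨c, rfl⟩ : ∃ d, c = d + 1 := ⟨c - 1, by rcases c with _ | c <;> simp_all⟩
      rw [show n = (m + 1) * c + m by linarith, Nat.mul_add_mod, Nat.mod_eq_of_lt (by omega)]
    · intro h
      exact ⟨n / (m + 1) + 1, by have := Nat.div_add_mod n (m + 1); linarith⟩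
  · rw [map_neg, map_one]
    ring_nf

variable [T2Space K]

lemma expand_qProd {p : ℕ} (hp : p ≠ 0) (ε : K) (a : ℕ) {s : ℕ} (hs : 0 < s) :
    expand p hp (qProd ε a s) = qProd ε (p * a) (p * s) := by
  have h := (hasProd_qProd ε a hs).map (expand p hp) (continuous_expand hp)
  refine h.unique ?_
  convert! hasProd_qProd ε (p * a) (s := p * s) (by positivity) using 2 with n
  simp only [Function.comp_apply, map_add, map_one, map_mul, map_pow, expand_X, expand_C]
  rw [← pow_mul]
  ring_nf

variable [IsTopologicalRing K]

lemma qProd_zero_left {s : ℕ} (hs : 0 < s) : (qProd 1 0 s : K⟦X⟧) = 2 * qProd 1 s s := by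
  have h := (hasProd_qProd (1 : K) s hs).multipliable
  rw [qProd, tprod_eq_zero_mul', qProd]
  · congr 1
    · norm_num
    · refine tprod_congr fun n ↦ ?_
      ring_nf
  · convert! h using 2 with n
    ring_nf

lemma qProd_one_mul_qProd_neg_one (a : ℕ) {s : ℕ} (hs : 0 < s) :
    (qProd 1 a s * qProd (-1) a s : K⟦X⟧) = qProd (-1) (2 * a) (2 * s) := by
  refine ((hasProd_qProd _ a hs).mul (hasProd_qProd _ a hs)).unique ?_
  convert! hasProd_qProd (-1 : K) (2 * a) (s := 2 * s) (by positivity) using 2 with n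
  simp only [map_one, map_neg]
  ring

lemma qProd_mul_qProd_mul_qProd (ε : K) (a : ℕ) {s : ℕ} (hs : 0 < s) :
    qProd ε a (3 * s) * qProd ε (a + s) (3 * s) * qProd ε (a + s * 2) (3 * s) = qProd ε a s := by
  have h0 := hasProd_ite_mod_eq ε a (m := 3) (j := 0) hs (by norm_num)
  have h1 := hasProd_ite_mod_eq ε a (m := 3) (j := 1) hs (by norm_num)
  have h2 := hasProd_ite_mod_eq ε a (m := 3) (j := 2) hs (by norm_num)
  rw [mul_zero, add_zero] at h0
  rw [mul_one] at h1
  refine ((h0.mul h1).mul h2).unique ?_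
  convert! hasProd_qProd ε a hs using 2 with n
  have : n % 3 < 3 := Nat.mod_lt _ (by norm_num)
  interval_cases n % 3 <;> simp

lemma eulerProd_ne_zero {k : ℕ} (hk : 0 < k) : eulerProd K k ≠ 0 := by
  obtain ⟨L, hL, -⟩ := tendsto_centralQBinomial (K := K) hk
  exact right_ne_zero_of_mul_eq_one hL

lemma one_sub_mul_one_sub_mul_one_sub {R : Type*} [CommRing R] {ω : R} (hω : 1 + ω + ω ^ 2 = 0)
    (m : ℕ) (y : R) :
    (1 - y) * (1 - ω ^ m * y) * (1 - (ω ^ 2) ^ m * y) =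
      if 3 ∣ m then (1 - y) ^ 3 else 1 - y ^ 3 := by
  have h3 : ω ^ 3 = 1 := by linear_combination (ω - 1) * hω
  obtain ⟨q, r, hr, rfl⟩ : ∃ q r, r < 3 ∧ m = 3 * q + r :=
    ⟨m / 3, m % 3, Nat.mod_lt _ (by norm_num), (Nat.div_add_mod m 3).symm⟩
  have h6 : (ω ^ 2) ^ 3 = 1 := by rw [← pow_mul, mul_comm, pow_mul, h3, one_pow]
  rw [pow_add, pow_mul, h3, pow_add (ω ^ 2), pow_mul (ω ^ 2) 3, h6, one_pow, one_mul,
    one_mul]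
  interval_cases r
  · simp
    ring
  · rw [if_neg (by omega)]
    linear_combination (-y + y ^ 2 * ω) * hω - y ^ 3 * h3
  · rw [if_neg (by omega)]
    linear_combination (-y + y ^ 2 * ω ^ 2) * (1 - ω + ω ^ 2) * hω - y ^ 3 * h6

/-- Multiplying an Euler product over its rotations by the cube roots of unity. -/
lemma eulerProd_mul_rescale_mul_rescale {ω : K} (hω : 1 + ω + ω ^ 2 = 0) {k : ℕ} (hk : ¬ 3 ∣ k) :
    eulerProd K k * rescale ω (eulerProd K k) * rescale (ω ^ 2) (eulerProd K k) *
      eulerProd K (9 * k) = eulerProd K (3 * k) ^ 4 := by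
  have hk0 : 0 < k := Nat.pos_of_ne_zero fun h ↦ hk (h ▸ dvd_zero 3)
  have h1 := hasProd_eulerProd (K := K) hk0
  have h3 := hasProd_eulerProd (K := K) (k := 3 * k) (by positivity)
  have h9 := hasProd_eulerProd_mul (K := K) (k := 3 * k) (m := 3) (by positivity) (by norm_num)
  have h3' := hasProd_eulerProd_mul (K := K) (m := 3) hk0 (by norm_num)
  rw [show 3 * (3 * k) = 9 * k by ring] at h9
  have hL := ((h1.mul (h1.map (rescale ω) (continuous_rescale ω))).mul
    (h1.map (rescale (ω ^ 2)) (continuous_rescale _))).mul h9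
  have hR := h3.mul ((h3'.mul h3').mul h3')
  rw [show eulerProd K (3 * k) ^ 4 = eulerProd K (3 * k) *
    (eulerProd K (3 * k) * eulerProd K (3 * k) * eulerProd K (3 * k)) by ring]
  refine hL.unique ?_
  convert! hR using 2 with n
  have hC : 1 + C ω + C ω ^ 2 = (0 : K⟦X⟧) := by
    rw [← map_one C, ← map_pow, ← map_add, ← map_add, hω, map_zero]
  have hdvd : 3 ∣ k * (n + 1) ↔ 3 ∣ n + 1 := by
    rw [Nat.prime_three.dvd_mul]
    tauto
  have h := one_sub_mul_one_sub_mul_one_sub hC (k * (n + 1)) (X ^ (k * (n + 1)))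
  simp only [Function.comp_apply, map_sub, map_one, map_pow, rescale_X, mul_pow, hdvd] at h ⊢
  rw [h]
  split_ifs <;> ring

end Products

section Trisection

variable {K : Type*} [Field K]

/-- The power series `∑ p_{3n} X ^ n`. -/
noncomputable def trisect (p : K⟦X⟧) : K⟦X⟧ := mk fun n ↦ coeff (3 * n) p

lemma trisect_add (p q : K⟦X⟧) : trisect (p + q) = trisect p + trisect q := by
  ext n
  simp [trisect]

lemma trisect_expand_mul (p q : K⟦X⟧) :
    trisect (expand 3 three_ne_zero p * q) = p * trisect q := by
  ext n
  rw [trisect, coeff_mk, coeff_mul, coeff_mul]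
  symm
  refine Finset.sum_of_injOn (fun x ↦ (3 * x.1, 3 * x.2)) (fun x _ y _ h ↦ ?_) (fun x hx ↦ ?_)
    (fun x hx h ↦ ?_) (fun x _ ↦ ?_)
  · simpa [Prod.ext_iff] using h
  · simp only [Finset.mem_coe, Finset.HasAntidiagonal.mem_antidiagonal] at hx ⊢
    omega
  · rw [coeff_expand, if_neg, zero_mul]
    rintro ⟨c, hc⟩
    rw [Finset.HasAntidiagonal.mem_antidiagonal] at hx
    refine h ⟨(c, n - c), ?_, ?_⟩
    · simp
      omega
    · ext <;> simp <;> omega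
  · simp [trisect]

lemma trisect_expand (p : K⟦X⟧) : trisect (expand 3 three_ne_zero p) = p := by
  ext n
  simp [trisect]

lemma trisect_expand_mul_X_pow (p : K⟦X⟧) {r : ℕ} (hr : ¬ 3 ∣ r) :
    trisect (expand 3 three_ne_zero p * X ^ r) = 0 := by
  rw [trisect_expand_mul]
  convert! mul_zero p
  ext n
  rw [trisect, coeff_mk, coeff_X_pow, if_neg (by omega), map_zero]

end Trisection

section Theta

variable (K : Type*) [Field K] [TopologicalSpace K]

/-- Ramanujan's theta function `ψ(X ^ k)`, as a product. -/
noncomputable def thetaPsi (k : ℕ) : K⟦X⟧ := qProd 1 k k ^ 2 * eulerProd K k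

/-- Ramanujan's theta function `f(X ^ k, X ^ (2k))`, as a product. -/
noncomputable def thetaA (k : ℕ) : K⟦X⟧ :=
  qProd 1 k (3 * k) * qProd 1 (2 * k) (3 * k) * eulerProd K (3 * k)

variable [T2Space K]

lemma expand_thetaPsi {k : ℕ} (hk : 0 < k) :
    expand 3 three_ne_zero (thetaPsi K k) = thetaPsi K (3 * k) := by
  simp [thetaPsi, expand_qProd, hk]

lemma expand_thetaA {k : ℕ} (hk : 0 < k) :
    expand 3 three_ne_zero (thetaA K k) = thetaA K (3 * k) := by
  simp [thetaA, expand_qProd, hk, Nat.mul_left_comm]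

variable [IsTopologicalRing K]

lemma hasSum_thetaPsi {k : ℕ} (hk : 0 < k) :
    HasSum (fun m ↦ (X : K⟦X⟧) ^ thetaExp 0 k m) (2 * thetaPsi K k) := by
  convert! hasSum_X_pow_thetaExp (K := K) (a := 0) (b := k) (by omega) using 1
  rw [zero_add, qProd_zero_left hk, thetaPsi]
  ring

lemma hasSum_thetaA {k : ℕ} (hk : 0 < k) :
    HasSum (fun m ↦ (X : K⟦X⟧) ^ thetaExp k (2 * k) m) (thetaA K k) := by
  convert! hasSum_X_pow_thetaExp (K := K) (a := k) (b := 2 * k) (by omega) using 1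
  rw [show k + 2 * k = 3 * k by ring, thetaA]

lemma thetaPsi_one_eq [NeZero (2 : K)] : thetaPsi K 1 = thetaA K 3 + X * thetaPsi K 9 := by
  have h := (((Int.divModEquiv 3).trans (Equiv.prodComm _ _)).symm.hasSum_iff.2
    (hasSum_thetaPsi K one_pos)).prod_fiberwise (g := ![thetaA K 3, thetaA K 3,
      X * (2 * thetaPsi K 9)]) ?_
  · have h2 : C 2⁻¹ * 2 = (1 : K⟦X⟧) := by
      rw [← map_ofNat C 2, ← map_mul, inv_mul_cancel₀ two_ne_zero, map_one]
    have := h.unique (hasSum_fintype _)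
    simp only [Fin.sum_univ_three, Matrix.cons_val] at this
    linear_combination C 2⁻¹ * this + (thetaA K 3 + X * thetaPsi K 9 - thetaPsi K 1) * h2
  · have hA := hasSum_thetaA K (k := 3) (by norm_num)
    have hP := hasSum_thetaPsi K (k := 9) (by norm_num)
    intro j
    fin_cases j
    · convert! hA using 2 with m
      simp
      have h1 := thetaExp_cast 0 1 (m * 3)
      have h2 := thetaExp_cast 3 6 m
      congr 1
      zify
      push_cast at *
      linarith
    · convert! (Equiv.neg ℤ).hasSum_iff.2 hA using 2 with m
      simp
      have h1 := thetaExp_cast 0 1 (m * 3 + 1)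
      have h2 := thetaExp_cast 3 6 (-m)
      congr 1
      zify
      push_cast at *
      linarith
    · convert! ((Equiv.neg ℤ).hasSum_iff.2 hP).mul_left X using 2 with m
      simp
      rw [← pow_succ']
      have h1 := thetaExp_cast 0 1 (m * 3 + 2)
      have h2 := thetaExp_cast 0 9 (-m)
      congr 1
      zify
      push_cast at *
      linarith

lemma thetaPsi_mul_eulerProd {k : ℕ} (hk : 0 < k) :
    thetaPsi K k * eulerProd K k = eulerProd K (2 * k) ^ 2 := by
  rw [thetaPsi, eulerProd, eulerProd, ← qProd_one_mul_qProd_neg_one k hk]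
  ring

lemma thetaA_mul_eulerProd :
    thetaA K 1 * eulerProd K 1 * eulerProd K 6 = eulerProd K 2 * eulerProd K 3 ^ 2 := by
  have h1 := qProd_one_mul_qProd_neg_one (K := K) 1 one_pos
  have h3 := qProd_one_mul_qProd_neg_one (K := K) 3 three_pos
  have h := qProd_mul_qProd_mul_qProd (1 : K) 1 one_pos
  norm_num [thetaA, eulerProd] at *
  rw [← h1, ← h3, ← h]
  ring

lemma thetaA_pow_three_add_mul_eulerProd [NeZero (2 : K)] {ω : K} (hω : 1 + ω + ω ^ 2 = 0) :
    (thetaA K 1 ^ 3 + X * thetaPsi K 3 ^ 3) * (eulerProd K 1 ^ 4 * eulerProd K 6 ^ 2) =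
      eulerProd K 2 ^ 8 * eulerProd K 3 := by
  have hω3 : ω ^ 3 = 1 := by linear_combination (ω - 1) * hω
  have hω6 : (ω ^ 2) ^ 3 = 1 := by rw [← pow_mul, mul_comm, pow_mul, hω3, one_pow]
  have hC : 1 + C ω + C ω ^ 2 = (0 : K⟦X⟧) := by
    rw [← map_one C, ← map_pow, ← map_add, ← map_add, hω, map_zero]
  have hA := expand_thetaA K one_pos
  have hP := expand_thetaPsi K three_pos
  have hψ := thetaPsi_one_eq K
  have hf := thetaPsi_mul_eulerProd K one_pos
  have hF1 := eulerProd_mul_rescale_mul_rescale hω (k := 1) (by norm_num)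
  have hF2 := eulerProd_mul_rescale_mul_rescale hω (k := 2) (by norm_num)
  norm_num at hA hP hf hF1 hF2
  have hrescale (c : K) (hc : c ^ 3 = 1) :
      rescale c (thetaPsi K 1) = thetaA K 3 + C c * X * thetaPsi K 9 := by
    rw [hψ, map_add, map_mul, rescale_X, ← hA, ← hP, rescale_expand _ hc, rescale_expand _ hc]
  have hf1 := congrArg (rescale ω) hf
  have hf2 := congrArg (rescale (ω ^ 2)) hf
  rw [map_mul, map_pow, hrescale _ hω3] at hf1
  rw [map_mul, map_pow, hrescale _ hω6, map_pow] at hf2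
  rw [hψ] at hf
  have hD : (thetaA K 3 ^ 3 + X ^ 3 * thetaPsi K 9 ^ 3) * (eulerProd K 3 ^ 4 * eulerProd K 18 ^ 2) =
      eulerProd K 6 ^ 8 * eulerProd K 9 := by
    have hprod : thetaA K 3 ^ 3 + X ^ 3 * thetaPsi K 9 ^ 3 = (thetaA K 3 + X * thetaPsi K 9) *
        (thetaA K 3 + C ω * X * thetaPsi K 9) * (thetaA K 3 + C ω ^ 2 * X * thetaPsi K 9) := by
      linear_combination (-thetaA K 3 ^ 2 * X * thetaPsi K 9 -
        C ω * thetaA K 3 * X ^ 2 * thetaPsi K 9 ^ 2 -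
        (C ω - 1) * X ^ 3 * thetaPsi K 9 ^ 3) * hC
    have := congrArg₂ (· * ·) (congrArg₂ (· * ·) hf hf1) hf2
    rw [← hF1, show eulerProd K 6 ^ 8 = (eulerProd K 6 ^ 4) ^ 2 by ring, ← hF2, hprod]
    linear_combination eulerProd K 9 * eulerProd K 18 ^ 2 * this
  rw [← trisect_expand ((thetaA K 1 ^ 3 + X * thetaPsi K 3 ^ 3) * _),
    ← trisect_expand (eulerProd K 2 ^ 8 * _)]
  congr 1
  simp only [map_mul, map_add, map_pow, expand_X, hA, hP]
  rw [expand_qProd, expand_qProd, expand_qProd, expand_qProd]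
  · exact hD
  all_goals norm_num

/-- If `P` is the power series `f₁ f₃ / f₂²`, where `f_k = ∏ (1 - X ^ (k n))`,
then extracting the coefficients at multiples of `3` cubes it. -/
theorem trisect_eq_pow_three [NeZero (2 : K)] {ω : K} (hω : 1 + ω + ω ^ 2 = 0) {P : K⟦X⟧}
    (hP : P * eulerProd K 2 ^ 2 = eulerProd K 1 * eulerProd K 3) : trisect P = P ^ 3 := by
  have h1 : eulerProd K 1 ≠ 0 := eulerProd_ne_zero one_pos
  have h2 : eulerProd K 2 ≠ 0 := eulerProd_ne_zero two_pos
  have h3 : eulerProd K 3 ≠ 0 := eulerProd_ne_zero three_pos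
  have hA := expand_thetaA K one_pos
  have hψ := expand_thetaPsi K three_pos
  have hf := expand_qProd three_ne_zero (-1 : K) 1 one_pos
  norm_num at hA hψ hf
  have hPψ : P * thetaPsi K 1 = eulerProd K 3 := by
    refine mul_left_cancel₀ h1 ?_
    linear_combination hP + P * thetaPsi_mul_eulerProd K one_pos
  have hD : trisect P * (thetaA K 1 ^ 3 + X * thetaPsi K 3 ^ 3) = eulerProd K 1 * thetaA K 1 ^ 2 := by
    have key : expand 3 three_ne_zero (thetaA K 1 ^ 3 + X * thetaPsi K 3 ^ 3) * P =
        expand 3 three_ne_zero (eulerProd K 1 * thetaA K 1 ^ 2) +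
        expand 3 three_ne_zero (-(eulerProd K 1 * thetaA K 1 * thetaPsi K 3)) * X ^ 1 +
        expand 3 three_ne_zero (eulerProd K 1 * thetaPsi K 3 ^ 2) * X ^ 2 := by
      simp only [map_mul, map_add, map_neg, map_pow, expand_X, hA, hψ, hf]
      rw [thetaPsi_one_eq] at hPψ
      linear_combination
        (thetaA K 3 ^ 2 - X * thetaA K 3 * thetaPsi K 9 + X ^ 2 * thetaPsi K 9 ^ 2) * hPψ
    have := congrArg trisect key
    rw [trisect_expand_mul, trisect_add, trisect_add, trisect_expand,
      trisect_expand_mul_X_pow _ (by norm_num), trisect_expand_mul_X_pow _ (by norm_num)] at this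
    linear_combination this
  have hA' := thetaA_mul_eulerProd K
  have hE := thetaA_pow_three_add_mul_eulerProd K hω
  have hfin : trisect P * (eulerProd K 2 ^ 8 * eulerProd K 3) =
      P ^ 3 * (eulerProd K 2 ^ 8 * eulerProd K 3) := by
    have hP3 := congrArg (· ^ 3) hP
    have hA2 := congrArg (· ^ 2) hA'
    linear_combination -trisect P * hE + eulerProd K 1 ^ 4 * eulerProd K 6 ^ 2 * hD +
      eulerProd K 1 ^ 3 * hA2 - eulerProd K 2 ^ 2 * eulerProd K 3 * hP3
  exact mul_right_cancel₀ (mul_ne_zero (pow_ne_zero _ h2) h3) hfin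

end Theta

section Partitions

/-- The multiplicities `c` that a part of size `i` may have. -/
def AdmissibleMultiplicity (i c : ℕ) : Prop :=
  if Even i then c ≤ 2 else c = 0 ∨ c = 1 ∨ c = 3 ∨ c = 4

instance (i c : ℕ) : Decidable (AdmissibleMultiplicity i c) := by
  unfold AdmissibleMultiplicity
  infer_instance

lemma card_eq_coeff_genFun {R : Type*} [CommSemiring R] (n : ℕ) :
    (Nat.card {lam : Multiset ℕ //
      (∀ i ∈ lam, 0 < i) ∧
      (∀ i, Even i → lam.count i ≤ 2) ∧
      (∀ i, Odd i →
        lam.count i = 0 ∨ lam.count i = 1 ∨ lam.count i = 3 ∨ lam.count i = 4) ∧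
      lam.sum = n} : R) =
    coeff n (Nat.Partition.genFun fun i c ↦ if AdmissibleMultiplicity i c then (1 : R) else 0) := by
  rw [Nat.Partition.coeff_genFun]
  simp_rw [Finsupp.prod, Finset.prod_boole, Finset.sum_boole]
  congr 1
  rw [← Fintype.card_subtype, ← Nat.card_eq_fintype_card]
  have hiff (lam : Multiset ℕ) :
      (∀ i ∈ lam.toFinsupp.support, AdmissibleMultiplicity i (lam.toFinsupp i)) ↔
      (∀ i, Even i → lam.count i ≤ 2) ∧ ∀ i, Odd i →
        lam.count i = 0 ∨ lam.count i = 1 ∨ lam.count i = 3 ∨ lam.count i = 4 := by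
    simp only [Multiset.toFinsupp_support, Multiset.mem_toFinset, Multiset.toFinsupp_apply,
      AdmissibleMultiplicity]
    constructor
    · intro h
      refine ⟨fun i hi ↦ ?_, fun i hi ↦ ?_⟩ <;> by_cases hm : i ∈ lam
      · simpa [hi] using h i hm
      · simp [Multiset.count_eq_zero_of_notMem hm]
      · simpa [Nat.not_even_iff_odd.2 hi] using h i hm
      · simp [Multiset.count_eq_zero_of_notMem hm]
    · intro h i _
      split_ifs with hi
      · exact h.1 i hi
      · exact h.2 i (Nat.not_even_iff_odd.1 hi)
  exact Nat.card_congr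
    { toFun lam := ⟨⟨lam.1, @lam.2.1, lam.2.2.2.2⟩, (hiff _).2 ⟨lam.2.2.1, lam.2.2.2.1⟩⟩
      invFun p := ⟨p.1.parts, fun _ ↦ p.1.parts_pos, ((hiff _).1 p.2).1, ((hiff _).1 p.2).2,
        p.1.parts_sum⟩
      left_inv _ := rfl
      right_inv _ := rfl }

lemma coeff_three_mul_of_trisect_rescale {K : Type*} [Field K] {S : K⟦X⟧}
    (h : trisect (rescale (-1) S) = rescale (-1) S ^ 3) (n : ℕ) :
    coeff (3 * n) S = coeff n (S ^ 3) := by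
  have := congrArg (coeff n) h
  rw [trisect, coeff_mk, ← map_pow, coeff_rescale, coeff_rescale, pow_mul] at this
  norm_num at this
  exact this

lemma coeff_pow_three {R : Type*} [CommSemiring R] (S : R⟦X⟧) (n : ℕ) :
    coeff n (S ^ 3) = ∑ t ∈ Finset.Nat.antidiagonalTuple 3 n,
      coeff (t 0) S * coeff (t 1) S * coeff (t 2) S := by
  rw [show S ^ 3 = ∏ _i : Fin 3, S by simp, coeff_prod]
  refine Finset.sum_bij' (fun t _ ↦ t) (fun t _ ↦ Finsupp.equivFunOnFinite.symm t) ?_ ?_ ?_ ?_ ?_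
  all_goals simp [Finset.Nat.mem_antidiagonalTuple, Fin.sum_univ_three, Fin.prod_univ_three]

variable {K : Type*} [Field K] [TopologicalSpace K] [T2Space K]

lemma hasProd_genFun_admissible :
    HasProd (fun n ↦ if Even (n + 1) then 1 + X ^ (n + 1) + X ^ (2 * (n + 1))
        else (1 + X ^ (n + 1)) * (1 + X ^ (3 * (n + 1))))
      (Nat.Partition.genFun fun i c ↦ if AdmissibleMultiplicity i c then (1 : K) else 0) := by
  convert! Nat.Partition.hasProd_genFun
    (fun i c ↦ if AdmissibleMultiplicity i c then (1 : K) else 0) using 2 with n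
  rw [tsum_eq_sum (s := Finset.range 4)]
  · simp only [Finset.sum_range_succ, Finset.sum_range_zero, AdmissibleMultiplicity]
    split_ifs <;> simp_all <;> ring_nf
  · intro c hc
    rw [Finset.mem_range, not_lt] at hc
    rw [if_neg, zero_smul]
    grind [AdmissibleMultiplicity]

variable [IsTopologicalRing K]

lemma rescale_genFun_mul_eulerProd :
    rescale (-1) (Nat.Partition.genFun fun i c ↦
      if AdmissibleMultiplicity i c then (1 : K) else 0) * eulerProd K 2 ^ 2 =
      eulerProd K 1 * eulerProd K 3 := by
  have h := (hasProd_genFun_admissible (K := K)).map (rescale (-1)) (continuous_rescale _)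
  have h1 := hasProd_eulerProd (K := K) one_pos
  have h3 := hasProd_eulerProd (K := K) three_pos
  have h2 := hasProd_eulerProd_mul (K := K) (k := 1) (m := 2) one_pos two_pos
  rw [sq]
  refine (h.mul (h2.mul h2)).unique ?_
  convert! h1.mul h3 using 2 with n
  simp only [Function.comp_apply, ← even_iff_two_dvd]
  split_ifs with hn
  · simp only [map_add, map_one, map_pow, rescale_X, map_neg, mul_pow, hn.neg_one_pow,
      (hn.mul_left 2).neg_one_pow]
    ring
  · have h3 : Odd (3 * (n + 1)) := Odd.mul (by decide) (Nat.not_even_iff_odd.1 hn)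
    simp only [map_mul, map_add, map_one, map_pow, rescale_X, map_neg, mul_pow,
      (Nat.not_even_iff_odd.1 hn).neg_one_pow, h3.neg_one_pow]
    ring

end Partitions

/-- If `g n` is the number of partitions of `n` in which every even part size occurs at
most twice and every odd part size occurs exactly once, exactly three times, or exactly
four times, if it occurs at all (OEIS A385520), then `g` is `3`-convolutive:
`g (3n) = ∑_{i+j+k=n} g i * g j * g k`. -/
theorem A385520_three_convolutive (g : ℕ → ℕ)
    (hg : ∀ n, g n = Nat.card {lam : Multiset ℕ //
      (∀ i ∈ lam, 0 < i) ∧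
      (∀ i, Even i → lam.count i ≤ 2) ∧
      (∀ i, Odd i →
        lam.count i = 0 ∨ lam.count i = 1 ∨ lam.count i = 3 ∨ lam.count i = 4) ∧
      lam.sum = n}) :
    ∀ n, g (3 * n) =
      ∑ t ∈ Finset.Nat.antidiagonalTuple 3 n, g (t 0) * g (t 1) * g (t 2) := by
  intro n
  obtain ⟨ω, hω⟩ : ∃ ω : ℂ, 1 + ω + ω ^ 2 = 0 := by
    have := (Complex.isPrimitiveRoot_exp 3 three_ne_zero).geom_sum_eq_zero (by norm_num)
    rw [Finset.sum_range_succ, Finset.sum_range_succ, Finset.sum_range_one, pow_zero,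
      pow_one] at this
    exact ⟨_, this⟩
  have h := coeff_three_mul_of_trisect_rescale
    (trisect_eq_pow_three ℂ hω rescale_genFun_mul_eulerProd) n
  rw [coeff_pow_three] at h
  simp only [← card_eq_coeff_genFun, ← hg] at h
  exact_mod_cast h
end

section
/- Let c(n) denote the number of triples (λ, μ, ν), where λ is a partition with no part divisible by 3 and no part divisible by 5, μ is a partition into distinct parts all divisible by 3, ν is a partition into distinct parts all divisible by 5, and |λ| + |μ| + |ν| = n. Let t₃(k) denote the number of partitions of k into parts divisible by 3 and t₅(l) the number of partitions of l into parts divisible by 5. Then for every natural number n, the number of pairs (λ, μ), where λ is an arbitrary partition, μ is a partition into parts divisible by 15, and |λ| + |μ| = 2n, equals Σ_{i+j+k+l=n} c(i) · c(j) · t₃(k) · t₅(l), the sum being over all quadruples of nonnegative integers with i + j + k + l = n. -/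
namespace PartitionHuffing

open PowerSeries PowerSeries.WithPiTopology Finset Filter Topology

theorem sum_telescope {R : Type*} [CommRing R] (q : R) (n m : ℕ) (hm : m ≤ n) :
    ∑ s ∈ range m, (∏ i ∈ Ico s (n + 1), (1 - q ^ (2 * i + 2))) *
        (∏ i ∈ range s, (1 - q ^ (2 * i + 1))) * q ^ (s * (2 * n + 3)) =
      (1 - q ^ (2 * n + 1)) * ∑ s ∈ range m, (∏ i ∈ Ico s n, (1 - q ^ (2 * i + 2))) *
        (∏ i ∈ range s, (1 - q ^ (2 * i + 1))) * q ^ (s * (2 * n + 1)) +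
      (1 - q ^ (2 * m)) * (∏ i ∈ Ico m n, (1 - q ^ (2 * i + 2))) *
        (∏ i ∈ range m, (1 - q ^ (2 * i + 1))) * q ^ (m * (2 * n + 1)) := by
  induction m with
  | zero => simp
  | succ m ih =>
    rw [sum_range_succ, ih (by omega), sum_range_succ, prod_range_succ,
      prod_Ico_succ_top (by omega : m ≤ n), prod_eq_prod_Ico_succ_bot (by omega : m < n)]
    ring

/-- A finite form of Gauss's identity for triangular numbers (D. Shanks). -/
theorem prod_mul_sum_triangular {R : Type*} [CommRing R] (q : R) (n : ℕ) :
    (∏ i ∈ range n, (1 - q ^ (2 * i + 1))) * ∑ t ∈ range (2 * n), q ^ (t * (t + 1) / 2) =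
      ∑ s ∈ range n, (∏ i ∈ Ico s n, (1 - q ^ (2 * i + 2))) *
        (∏ i ∈ range s, (1 - q ^ (2 * i + 1))) * q ^ (s * (2 * n + 1)) := by
  induction n with
  | zero => simp
  | succ n ih =>
    have h₁ : 2 * n * (2 * n + 1) / 2 = n * (2 * n + 1) := by
      rw [mul_assoc, Nat.mul_div_cancel_left _ two_pos]
    have h₂ : (2 * n + 1) * (2 * n + 1 + 1) / 2 = (n + 1) * (2 * n + 1) := by
      rw [show (2 * n + 1) * (2 * n + 1 + 1) = 2 * ((n + 1) * (2 * n + 1)) by ring,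
        Nat.mul_div_cancel_left _ two_pos]
    rw [show 2 * (n + 1) = 2 * n + 1 + 1 by ring, sum_range_succ, sum_range_succ, h₁, h₂,
      sum_range_succ _ n, sum_telescope q n n le_rfl, ← ih, prod_range_succ, Ico_self,
      prod_Ico_succ_top le_rfl, Ico_self]
    simp only [prod_empty]
    ring

/-- The Euler product `f_k = ∏ (1 - X ^ (k n))`, the product being over `n ≥ 1`. -/
noncomputable def eulerProd (k : ℕ) : ℤ⟦X⟧ := ∏' n : ℕ, (1 - X ^ (k * (n + 1)))

theorem continuous_expand {k : ℕ} (hk : k ≠ 0) :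
    Continuous (PowerSeries.expand k hk : ℤ⟦X⟧ →ₐ[ℤ] ℤ⟦X⟧) := by
  rw [continuous_iff_continuousAt]
  intro f
  refine (tendsto_iff_coeff_tendsto _ _ _ _).2 fun d ↦ ?_
  simp only [coeff_expand]
  split_ifs
  · exact (continuous_coeff ℤ _).continuousAt
  · exact tendsto_const_nhds

theorem hasProd_eulerProd {k : ℕ} (hk : k ≠ 0) :
    HasProd (fun n : ℕ ↦ (1 - X ^ (k * (n + 1)) : ℤ⟦X⟧)) (eulerProd k) := by
  have h := (multipliable_one_sub_X_pow ℤ).hasProd.map (PowerSeries.expand k hk)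
    (continuous_expand hk)
  simp only [Function.comp_def, map_sub, map_one, map_pow, expand_X, ← pow_mul] at h
  exact h.multipliable.hasProd

theorem expand_eulerProd {j k : ℕ} (hj : j ≠ 0) (hk : k ≠ 0) :
    PowerSeries.expand j hj (eulerProd k) = eulerProd (j * k) := by
  have h := (hasProd_eulerProd hk).map (PowerSeries.expand j hj) (continuous_expand hj)
  simp only [Function.comp_def, map_sub, map_one, map_pow, expand_X, ← pow_mul, ← mul_assoc] at h
  exact h.unique (hasProd_eulerProd (mul_ne_zero hj hk))

theorem eulerProd_ne_zero {k : ℕ} (hk : k ≠ 0) : eulerProd k ≠ 0 := by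
  intro h
  have h₁ := (hasProd_eulerProd hk).map constantCoeff (continuous_constantCoeff ℤ)
  simp [Function.comp_def, h, hk] at h₁
  exact one_ne_zero (hasProd_one.unique h₁)

/-- `ψ(X ^ k)`, where `ψ` is the generating function of the triangular numbers. -/
noncomputable def triangularSeries (k : ℕ) : ℤ⟦X⟧ :=
  .mk fun n ↦ ∑ t ∈ range (n + 1), if k * (t * (t + 1) / 2) = n then 1 else 0

theorem le_triangular (t : ℕ) : t ≤ t * (t + 1) / 2 := by
  rw [Nat.le_div_iff_mul_le two_pos]
  rcases t with _ | t <;> nlinarith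

theorem coeff_triangularSeries {k n N : ℕ} (hk : k ≠ 0) (hN : n < N) :
    coeff n (triangularSeries k) =
      ∑ t ∈ range N, if k * (t * (t + 1) / 2) = n then 1 else 0 := by
  rw [triangularSeries, coeff_mk]
  refine sum_subset (by simpa using hN) fun t _ ht ↦ if_neg fun h ↦ ht ?_
  have := Nat.le_mul_of_pos_left (t * (t + 1) / 2) (Nat.pos_of_ne_zero hk)
  have := le_triangular t
  simp only [mem_range]
  omega

theorem tendsto_triangularSeries {k : ℕ} (hk : k ≠ 0) :
    Tendsto (fun n ↦ ∑ t ∈ range n, (X ^ k : ℤ⟦X⟧) ^ (t * (t + 1) / 2)) atTop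
      (𝓝 (triangularSeries k)) := by
  refine (tendsto_iff_coeff_tendsto _ _ _ _).2 fun d ↦
    tendsto_atTop_of_eventually_const (i₀ := d + 1) fun n hn ↦ ?_
  rw [coeff_triangularSeries hk hn, map_sum]
  simp [← pow_mul, coeff_X_pow, eq_comm]

/-- Gauss's identity `ψ(q) = f₂² / f₁`. -/
theorem triangularSeries_mul_eulerProd {k : ℕ} (hk : k ≠ 0) :
    triangularSeries k * eulerProd k = eulerProd (2 * k) ^ 2 := by
  set q : ℤ⟦X⟧ := X ^ k with hq
  have hE := (hasProd_eulerProd hk).tendsto_prod_nat.comp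
    (tendsto_id.const_mul_atTop' (two_pos (α := ℕ)))
  have hE₂ := (hasProd_eulerProd (mul_ne_zero two_ne_zero hk)).tendsto_prod_nat
  have hψ := (tendsto_triangularSeries hk).comp
    (tendsto_id.const_mul_atTop' (two_pos (α := ℕ)))
  simp only [pow_mul, ← hq, Function.comp_def, id] at hE hψ
  replace hE₂ : Tendsto (fun n ↦ ∏ i ∈ range n, (1 - q ^ (2 * i + 2))) atTop
      (𝓝 (eulerProd (2 * k))) := by
    refine hE₂.congr fun n ↦ prod_congr rfl fun i _ ↦ ?_
    rw [hq, ← pow_mul]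
    ring_nf
  have hsplit (n : ℕ) : ∏ i ∈ range (2 * n), (1 - q ^ (i + 1)) =
      (∏ i ∈ range n, (1 - q ^ (2 * i + 1))) * ∏ i ∈ range n, (1 - q ^ (2 * i + 2)) := by
    induction n with
    | zero => simp
    | succ n ih =>
      rw [show 2 * (n + 1) = 2 * n + 1 + 1 by ring, prod_range_succ, prod_range_succ, ih,
        prod_range_succ, prod_range_succ]
      ring
  have hrem : Tendsto (fun n ↦ ∑ s ∈ range n, (∏ i ∈ Ico s n, (1 - q ^ (2 * i + 2))) *
      (∏ i ∈ range s, (1 - q ^ (2 * i + 1))) * q ^ (s * (2 * n + 1))) atTop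
      (𝓝 (eulerProd (2 * k))) := by
    rw [← add_zero (eulerProd (2 * k))]
    have h₀ : Tendsto (fun n ↦ ∑ s ∈ range n, (∏ i ∈ Ico (s + 1) (n + 1), (1 - q ^ (2 * i + 2))) *
        (∏ i ∈ range (s + 1), (1 - q ^ (2 * i + 1))) * q ^ ((s + 1) * (2 * (n + 1) + 1)))
        atTop (𝓝 0) := by
      refine (tendsto_iff_coeff_tendsto _ _ _ _).2 fun d ↦
        tendsto_atTop_of_eventually_const (i₀ := d) fun n hn ↦ ?_
      rw [map_sum, map_zero]
      refine sum_eq_zero fun s _ ↦ ?_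
      rw [hq, ← pow_mul, coeff_mul_X_pow', if_neg]
      have : 1 * (1 * (2 * (n + 1) + 1)) ≤ k * ((s + 1) * (2 * (n + 1) + 1)) := by
        gcongr <;> omega
      omega
    refine (tendsto_add_atTop_iff_nat 1).1
      ((((tendsto_add_atTop_iff_nat 1).2 hE₂).add h₀).congr fun n ↦ ?_)
    rw [sum_range_succ']
    simp [add_comm]
  simp_rw [← prod_mul_sum_triangular] at hrem
  refine tendsto_nhds_unique (hψ.mul hE) ?_
  rw [sq]
  refine (hrem.mul hE₂).congr fun n ↦ ?_
  rw [hsplit]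
  ring

/-- In terms of odd numbers, the map `(u, v) ↦ ((3 u ± 5 v) / 2, (u ∓ v) / 2)` turns solutions of
`3 u² + 5 v² = 8 n + 8` into solutions of `x² + 15 y² = 16 n + 16`. -/
theorem card_triangular_pairs (n : ℕ) :
    Nat.card {p : ℕ × ℕ // 1 * (p.1 * (p.1 + 1) / 2) + 15 * (p.2 * (p.2 + 1) / 2) = 2 * n} =
    Nat.card {p : ℕ × ℕ // 3 * (p.1 * (p.1 + 1) / 2) + 5 * (p.2 * (p.2 + 1) / 2) = n} := by
  have htri (t : ℕ) : 2 * (t * (t + 1) / 2) = t * (t + 1) :=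
    Nat.mul_div_cancel' (Nat.even_mul_succ_self t).two_dvd
  symm
  let f (p : ℕ × ℕ) : ℕ × ℕ :=
    if (p.1 + p.2) % 2 = 1 then ((3 * p.1 + 5 * p.2 + 3) / 2, ((p.1 - p.2 : ℤ).natAbs - 1) / 2)
    else (((3 * p.1 - 5 * p.2 - 1 : ℤ).natAbs - 1) / 2, (p.1 + p.2) / 2)
  have hnorm (c d : ℕ) : (2 * ((f (c, d)).1 : ℤ) + 1) ^ 2 + 15 * (2 * ((f (c, d)).2 : ℤ) + 1) ^ 2 =
      6 * (2 * c + 1) ^ 2 + 10 * (2 * d + 1) ^ 2 := by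
    by_cases hp : (c + d) % 2 = 1
    · have h₁ : 2 * ((f (c, d)).1 : ℤ) + 1 = 3 * c + 5 * d + 4 := by
        simp only [f, hp, if_true]; omega
      have h₂ : 2 * ((f (c, d)).2 : ℤ) + 1 = (c - d : ℤ).natAbs := by
        simp only [f, hp, if_true]; omega
      rw [h₁, h₂, Int.natAbs_sq]
      ring
    · have h₁ : 2 * ((f (c, d)).1 : ℤ) + 1 = (3 * c - 5 * d - 1 : ℤ).natAbs := by
        simp only [f, hp, if_false]; omega
      have h₂ : 2 * ((f (c, d)).2 : ℤ) + 1 = c + d + 1 := by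
        simp only [f, hp, if_false]; push_cast; omega
      rw [h₁, h₂, Int.natAbs_sq]
      ring
  have hf (p : ℕ × ℕ) : 3 * (p.1 * (p.1 + 1) / 2) + 5 * (p.2 * (p.2 + 1) / 2) = n ↔
      1 * ((f p).1 * ((f p).1 + 1) / 2) + 15 * ((f p).2 * ((f p).2 + 1) / 2) = 2 * n := by
    obtain ⟨c, d⟩ := p
    have h := hnorm c d
    generalize f (c, d) = r at h ⊢
    have hc := htri c
    have hd := htri d
    have ha := htri r.1
    have hb := htri r.2
    dsimp only
    generalize c * (c + 1) / 2 = C at *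
    generalize d * (d + 1) / 2 = D at *
    generalize r.1 * (r.1 + 1) / 2 = A at *
    generalize r.2 * (r.2 + 1) / 2 = B at *
    zify at *
    constructor <;> intro <;> linarith
  refine Nat.card_eq_of_bijective (Subtype.map f fun p ↦ (hf p).1) ⟨?_, ?_⟩
  · refine Subtype.map_injective _ fun ⟨c, d⟩ ⟨c', d'⟩ h ↦ ?_
    simp only [f] at h
    split_ifs at h <;> simp only [Prod.mk.injEq] at h ⊢ <;> omega
  · rintro ⟨⟨a, b⟩, h⟩
    obtain ⟨p, hp⟩ : ∃ p, f p = (a, b) := by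
      dsimp only at h
      have ha := htri a
      have hb := htri b
      have hmod : ((2 * a + 1 : ℤ) + (2 * b + 1)) % 8 = 0 ∨
          ((2 * a + 1 : ℤ) - (2 * b + 1)) % 8 = 0 := by
        have h₁ : (a * (a + 1) + 15 * (b * (b + 1))) % 4 = 0 := by omega
        have ha' : a % 4 = 0 ∨ a % 4 = 1 ∨ a % 4 = 2 ∨ a % 4 = 3 := by omega
        have hb' : b % 4 = 0 ∨ b % 4 = 1 ∨ b % 4 = 2 ∨ b % 4 = 3 := by omega
        rcases ha' with h' | h' | h' | h' <;> rcases hb' with h'' | h'' | h'' | h'' <;>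
          simp [Nat.add_mod, Nat.mul_mod, h', h''] at h₁ <;> omega
      obtain ⟨y, hy, hxy⟩ : ∃ y : ℤ, (y = 2 * b + 1 ∨ y = - (2 * b + 1)) ∧
          ((2 * a + 1 : ℤ) + y) % 8 = 0 := by
        rcases hmod with h | h
        exacts [⟨_, .inl rfl, h⟩, ⟨_, .inr rfl, by omega⟩]
      clear h ha hb
      refine ⟨((((2 * a + 1 + 5 * y) / 4).natAbs - 1) / 2,
        (((2 * a + 1 - 3 * y) / 4).natAbs - 1) / 2), ?_⟩
      simp only [f]
      split_ifs <;> simp only [Prod.mk.injEq] <;> omega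
    exact ⟨⟨p, (hf p).2 (by rw [hp]; exact h)⟩, Subtype.ext hp⟩


/-- The generating function, by the weight `w`, of the elements with the property `P`. -/
noncomputable def weightSeries {α : Type*} (P : α → Prop) (w : α → ℕ) : ℤ⟦X⟧ :=
  .mk fun n ↦ (Nat.card {a // P a ∧ w a = n} : ℤ)

/-- Splitting the pairs of total weight `n` by the weights of the two components. -/
def weightProdEquiv {α β : Type*} (P : α → Prop) (w : α → ℕ) (Q : β → Prop) (v : β → ℕ) (n : ℕ) :
    {p : α × β // (P p.1 ∧ Q p.2) ∧ w p.1 + v p.2 = n} ≃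
      Σ ij : antidiagonal n, {a // P a ∧ w a = ij.1.1} × {b // Q b ∧ v b = ij.1.2} where
  toFun p := ⟨⟨(w p.1.1, v p.1.2), HasAntidiagonal.mem_antidiagonal.2 p.2.2⟩,
    ⟨p.1.1, p.2.1.1, rfl⟩, ⟨p.1.2, p.2.1.2, rfl⟩⟩
  invFun s := ⟨(s.2.1.1, s.2.2.1), ⟨s.2.1.2.1, s.2.2.2.1⟩, by
    rw [s.2.1.2.2, s.2.2.2.2]; exact HasAntidiagonal.mem_antidiagonal.1 s.1.2⟩
  left_inv _ := rfl
  right_inv := by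
    rintro ⟨⟨⟨i, j⟩, h⟩, ⟨a, ha, ha'⟩, ⟨b, hb, hb'⟩⟩
    dsimp only at ha' hb'
    subst ha' hb'
    rfl

theorem finite_weight_prod {α β : Type*} {P : α → Prop} {w : α → ℕ} {Q : β → Prop} {v : β → ℕ}
    (hP : ∀ n, Finite {a // P a ∧ w a = n}) (hQ : ∀ n, Finite {b // Q b ∧ v b = n}) (n : ℕ) :
    Finite {p : α × β // (P p.1 ∧ Q p.2) ∧ w p.1 + v p.2 = n} :=
  Finite.of_equiv _ (weightProdEquiv P w Q v n).symm

theorem weightSeries_mul {α β : Type*} {P : α → Prop} {w : α → ℕ} {Q : β → Prop} {v : β → ℕ}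
    (hP : ∀ n, Finite {a // P a ∧ w a = n}) (hQ : ∀ n, Finite {b // Q b ∧ v b = n}) :
    weightSeries P w * weightSeries Q v =
      weightSeries (fun p : α × β ↦ P p.1 ∧ Q p.2) (fun p ↦ w p.1 + v p.2) := by
  ext n
  rw [coeff_mul]
  simp only [weightSeries, coeff_mk]
  rw [Nat.card_congr (weightProdEquiv P w Q v n), Nat.card_sigma]
  simp only [Nat.card_prod]
  rw [sum_coe_sort (antidiagonal n)
    fun ij ↦ Nat.card {a // P a ∧ w a = ij.1} * Nat.card {b // Q b ∧ v b = ij.2}]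
  push_cast
  rfl

/-- Multisets of positive integers with sum `n` are the partitions of `n`. -/
def multisetEquivPartition {P : Multiset ℕ → Prop} (hP : ∀ m, P m → ∀ a ∈ m, 0 < a) (n : ℕ) :
    {m : Multiset ℕ // P m ∧ m.sum = n} ≃ {p : n.Partition // P p.parts} where
  toFun m := ⟨⟨m.1, @(hP m.1 m.2.1), m.2.2⟩, m.2.1⟩
  invFun p := ⟨p.1.parts, p.2, p.1.parts_sum⟩
  left_inv _ := rfl
  right_inv _ := rfl

theorem finite_multiset_sum {P : Multiset ℕ → Prop} (hP : ∀ m, P m → ∀ a ∈ m, 0 < a) (n : ℕ) :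
    Finite {m : Multiset ℕ // P m ∧ m.sum = n} :=
  Finite.of_equiv _ (multisetEquivPartition hP n).symm

theorem coeff_weightSeries_sum {P : Multiset ℕ → Prop} [DecidablePred P]
    (hP : ∀ m, P m → ∀ a ∈ m, 0 < a) (n : ℕ) :
    coeff n (weightSeries P Multiset.sum) = #{p : n.Partition | P p.parts} := by
  rw [weightSeries, coeff_mk, Nat.card_congr (multisetEquivPartition hP n),
    Nat.card_eq_fintype_card, Fintype.card_subtype]

/-- The generating function of the partitions all of whose parts satisfy `p`. -/
noncomputable def partSeries (p : ℕ → Prop) : ℤ⟦X⟧ :=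
  weightSeries (fun m : Multiset ℕ ↦ ∀ a ∈ m, 0 < a ∧ p a) Multiset.sum

/-- The generating function of the partitions into distinct multiples of `k`. -/
noncomputable def distinctSeries (k : ℕ) : ℤ⟦X⟧ :=
  weightSeries (fun m : Multiset ℕ ↦ (∀ a ∈ m, 0 < a ∧ k ∣ a) ∧ m.Nodup) Multiset.sum

theorem hasProd_partSeries (p : ℕ → Prop) [DecidablePred p] :
    HasProd (fun i ↦ if p (i + 1) then ∑' j : ℕ, (X ^ (i + 1)) ^ j else 1) (partSeries p) := by
  simp only [← pow_mul]
  convert! Nat.Partition.hasProd_powerSeriesMk_card_restricted ℤ p using 1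
  ext n
  rw [partSeries, coeff_weightSeries_sum fun m h a ha ↦ (h a ha).1, coeff_mk,
    Nat.Partition.restricted]
  congr 2
  ext q
  simp only [mem_filter, mem_univ, true_and]
  exact ⟨fun h a ha ↦ (h a ha).2, fun h a ha ↦ ⟨q.parts_pos ha, h a ha⟩⟩

theorem hasProd_distinctSeries (k : ℕ) :
    HasProd (fun i ↦ if k ∣ i + 1 then 1 + X ^ (i + 1) else 1) (distinctSeries k) := by
  convert! Nat.Partition.hasProd_genFun (R := ℤ) fun i c ↦ if k ∣ i ∧ c = 1 then 1 else 0 using 1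
  · ext1 i
    rw [tsum_eq_single 0 fun j hj ↦ by
      rw [if_neg (by simp [hj])]; exact zero_smul ℤ (X ^ _ : ℤ⟦X⟧)]
    split_ifs with h h' h'
    · rw [zero_add, mul_one]
      exact congrArg (1 + ·) (one_smul ℤ (X ^ (i + 1) : ℤ⟦X⟧)).symm
    · simp [h] at h'
    · simp [h] at h'
    · exact (add_eq_left.2 (zero_smul ℤ (X ^ _ : ℤ⟦X⟧))).symm
  · ext n
    classical
    rw [distinctSeries, coeff_weightSeries_sum fun m h a ha ↦ (h.1 a ha).1,
      Nat.Partition.coeff_genFun]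
    simp_rw [Finsupp.prod, prod_boole, ← Finset.natCast_card_filter]
    congr 2
    ext q
    simp only [mem_filter, mem_univ, true_and, Multiset.toFinsupp_support, Multiset.mem_toFinset,
      Multiset.toFinsupp_apply]
    refine ⟨fun h a ha ↦ ⟨(h.1 a ha).2, Multiset.count_eq_one_of_mem h.2 ha⟩, fun h ↦
      ⟨fun a ha ↦ ⟨q.parts_pos ha, (h a ha).1⟩, Multiset.nodup_iff_count_le_one.2 fun a ↦ ?_⟩⟩
    by_cases ha : a ∈ q.parts
    · exact (h a ha).2.le
    · simp [ha]

theorem hasProd_ite_dvd_iff {k : ℕ} (hk : k ≠ 0) {F : ℕ → ℤ⟦X⟧} {a : ℤ⟦X⟧} :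
    HasProd (fun i ↦ if k ∣ i + 1 then F (i + 1) else 1) a ↔
      HasProd (fun n ↦ F (k * (n + 1))) a := by
  have hpos (n : ℕ) : k * (n + 1) - 1 + 1 = k * (n + 1) :=
    Nat.sub_add_cancel (Nat.mul_pos (Nat.pos_of_ne_zero hk) n.succ_pos)
  have hinj : Function.Injective fun n ↦ k * (n + 1) - 1 := fun m n h ↦ by
    have : k * (m + 1) = k * (n + 1) := by rw [← hpos, ← hpos n]; exact congrArg (· + 1) h
    simpa [hk] using this
  rw [← hinj.hasProd_iff]
  · simp [Function.comp_def, hpos]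
  · intro i hi
    refine if_neg fun ⟨j, hj⟩ ↦ hi ⟨j - 1, ?_⟩
    rcases j with _ | j
    · simp at hj
    · simp [← hj]

theorem hasProd_eulerProd_ite {k : ℕ} (hk : k ≠ 0) :
    HasProd (fun i ↦ if k ∣ i + 1 then 1 - X ^ (i + 1) else 1) (eulerProd k) :=
  (hasProd_ite_dvd_iff hk (F := fun i ↦ 1 - X ^ i)).2 (hasProd_eulerProd hk)

theorem tsum_X_pow_mul (i : ℕ) : (∑' j : ℕ, ((X : ℤ⟦X⟧) ^ (i + 1)) ^ j) * (1 - X ^ (i + 1)) = 1 :=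
  tsum_pow_mul_one_sub_of_constantCoeff_eq_zero (by simp)

theorem partSeries_dvd_mul_eulerProd {k : ℕ} (hk : k ≠ 0) :
    partSeries (k ∣ ·) * eulerProd k = 1 := by
  refine ((hasProd_partSeries (k ∣ ·)).mul (hasProd_eulerProd_ite hk)).unique ?_
  convert hasProd_one using 2 with i
  split_ifs <;> simp [tsum_X_pow_mul]

theorem distinctSeries_mul_eulerProd {k : ℕ} (hk : k ≠ 0) :
    distinctSeries k * eulerProd k = eulerProd (2 * k) := by
  have h := (hasProd_ite_dvd_iff hk (F := fun i ↦ 1 + X ^ i)).1 (hasProd_distinctSeries k)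
  refine (h.mul (hasProd_eulerProd hk)).unique ?_
  convert hasProd_eulerProd (mul_ne_zero two_ne_zero hk) using 2 with i
  ring

theorem partSeries_not_dvd_mul_eulerProd {j k : ℕ} (hj : j ≠ 0) (hk : k ≠ 0) (h : j.Coprime k) :
    partSeries (fun a ↦ ¬ j ∣ a ∧ ¬ k ∣ a) * eulerProd 1 * eulerProd (j * k) =
      eulerProd j * eulerProd k := by
  refine (((hasProd_partSeries fun a ↦ ¬ j ∣ a ∧ ¬ k ∣ a).mul
    (hasProd_eulerProd_ite one_ne_zero)).mul (hasProd_eulerProd_ite (mul_ne_zero hj hk))).unique ?_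
  convert (hasProd_eulerProd_ite hj).mul (hasProd_eulerProd_ite hk) using 2 with i
  have hdvd : j * k ∣ i + 1 ↔ j ∣ i + 1 ∧ k ∣ i + 1 :=
    ⟨fun h' ↦ ⟨dvd_of_mul_right_dvd h', dvd_of_mul_left_dvd h'⟩,
      fun h' ↦ h.mul_dvd_of_dvd_of_dvd h'.1 h'.2⟩
  by_cases h₁ : j ∣ i + 1 <;> by_cases h₂ : k ∣ i + 1 <;> simp [hdvd, h₁, h₂, tsum_X_pow_mul]

theorem coeff_triangularSeries_mul {j k : ℕ} (hj : j ≠ 0) (hk : k ≠ 0) (n : ℕ) :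
    coeff n (triangularSeries j * triangularSeries k) =
      Nat.card {p : ℕ × ℕ // j * (p.1 * (p.1 + 1) / 2) + k * (p.2 * (p.2 + 1) / 2) = n} := by
  have hle {l t : ℕ} (hl : l ≠ 0) : t ≤ l * (t * (t + 1) / 2) :=
    (le_triangular t).trans (Nat.le_mul_of_pos_left _ (Nat.pos_of_ne_zero hl))
  have hsub : {p : ℕ × ℕ | j * (p.1 * (p.1 + 1) / 2) + k * (p.2 * (p.2 + 1) / 2) = n} =
      ({p ∈ range (n + 1) ×ˢ range (n + 1) |
        j * (p.1 * (p.1 + 1) / 2) + k * (p.2 * (p.2 + 1) / 2) = n} : Finset (ℕ × ℕ)) := by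
    ext ⟨a, b⟩
    have := hle (t := a) hj
    have := hle (t := b) hk
    simp only [Set.mem_ofPred_eq, coe_filter, mem_product, mem_range]
    omega
  have hcard : Nat.card {p : ℕ × ℕ // j * (p.1 * (p.1 + 1) / 2) + k * (p.2 * (p.2 + 1) / 2) = n} =
      Set.ncard {p : ℕ × ℕ | j * (p.1 * (p.1 + 1) / 2) + k * (p.2 * (p.2 + 1) / 2) = n} := rfl
  rw [hcard, hsub, Set.ncard_coe_finset, natCast_card_filter, sum_product, coeff_mul]
  calc
    _ = ∑ x ∈ antidiagonal n, ∑ a ∈ range (n + 1), ∑ b ∈ range (n + 1),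
        if (j * (a * (a + 1) / 2), k * (b * (b + 1) / 2)) = x then (1 : ℤ) else 0 := by
      refine sum_congr rfl fun x hx ↦ ?_
      have := HasAntidiagonal.mem_antidiagonal.1 hx
      rw [coeff_triangularSeries hj (by omega : x.1 < n + 1),
        coeff_triangularSeries hk (by omega : x.2 < n + 1), sum_mul_sum]
      simp only [← ite_and, Prod.ext_iff, ite_mul, one_mul, zero_mul]
    _ = _ := by
      rw [sum_comm]
      refine sum_congr rfl fun a _ ↦ ?_
      rw [sum_comm]
      refine sum_congr rfl fun b _ ↦ ?_
      rw [sum_ite_eq]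
      simp only [HasAntidiagonal.mem_antidiagonal]

/-- The terms of even exponent of `f`, with `X ^ 2` replaced by `X`. -/
noncomputable def evenPart (f : ℤ⟦X⟧) : ℤ⟦X⟧ := .mk fun n ↦ coeff (2 * n) f

theorem evenPart_mul_expand (f g : ℤ⟦X⟧) :
    evenPart (f * PowerSeries.expand 2 two_ne_zero g) = evenPart f * g := by
  ext n
  simp only [evenPart, coeff_mk, coeff_mul]
  refine (sum_of_injOn (fun x ↦ (2 * x.1, 2 * x.2)) ?_ ?_ ?_ ?_).symm
  · intro x _ y _ h
    simp only [Prod.mk.injEq] at h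
    ext <;> omega
  · intro x hx
    simp only [mem_coe, HasAntidiagonal.mem_antidiagonal] at hx ⊢
    omega
  · rintro ⟨i, j⟩ hx h
    rw [coeff_expand_of_not_dvd _ _ _ fun hj ↦ h ?_, mul_zero]
    rw [HasAntidiagonal.mem_antidiagonal] at hx
    obtain ⟨l, hl⟩ := hj
    refine ⟨(n - l, l), ?_, ?_⟩
    · simp only [mem_coe, HasAntidiagonal.mem_antidiagonal]; omega
    · ext <;> simp only <;> omega
  · intro x _
    rw [coeff_expand_mul]

theorem evenPart_triangularSeries :
    evenPart (triangularSeries 1 * triangularSeries 15) =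
      triangularSeries 3 * triangularSeries 5 := by
  ext n
  rw [evenPart, coeff_mk, coeff_triangularSeries_mul one_ne_zero (by norm_num),
    coeff_triangularSeries_mul (by norm_num) (by norm_num), card_triangular_pairs]

theorem evenPart_partSeries :
    evenPart (partSeries (1 ∣ ·) * partSeries (15 ∣ ·)) =
      (partSeries (fun a ↦ ¬ 3 ∣ a ∧ ¬ 5 ∣ a) * (distinctSeries 3 * distinctSeries 5)) ^ 2 *
        partSeries (3 ∣ ·) * partSeries (5 ∣ ·) := by
  have hψ {k : ℕ} (hk : k ≠ 0) :
      triangularSeries k = partSeries (k ∣ ·) * eulerProd (2 * k) ^ 2 := by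
    rw [← triangularSeries_mul_eulerProd hk, mul_left_comm, partSeries_dvd_mul_eulerProd hk,
      mul_one]
  have h := evenPart_triangularSeries
  rw [hψ one_ne_zero, hψ (k := 15) (by norm_num), hψ (k := 3) (by norm_num),
    hψ (k := 5) (by norm_num), ← expand_eulerProd two_ne_zero one_ne_zero,
    ← expand_eulerProd (k := 15) two_ne_zero (by norm_num), mul_mul_mul_comm, ← map_pow, ← map_pow,
    ← map_mul, evenPart_mul_expand, ← distinctSeries_mul_eulerProd (k := 3) (by norm_num),
    ← distinctSeries_mul_eulerProd (k := 5) (by norm_num)] at h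
  have hc := partSeries_not_dvd_mul_eulerProd (j := 3) (k := 5) (by norm_num) (by norm_num)
    (by norm_num)
  have hne : eulerProd 1 ^ 2 * eulerProd 15 ^ 2 ≠ 0 :=
    mul_ne_zero (pow_ne_zero _ (eulerProd_ne_zero one_ne_zero))
      (pow_ne_zero _ (eulerProd_ne_zero (by norm_num)))
  refine mul_right_cancel₀ hne (h.trans ?_)
  linear_combination (-(distinctSeries 3 * distinctSeries 5) ^ 2 * partSeries (3 ∣ ·) *
    partSeries (5 ∣ ·) * (partSeries (fun a ↦ ¬ 3 ∣ a ∧ ¬ 5 ∣ a) * eulerProd 1 * eulerProd 15 +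
      eulerProd 3 * eulerProd 5)) * hc

theorem sum_antidiagonalTuple_four (f : Fin 4 → ℤ⟦X⟧) (n : ℕ) :
    ∑ t ∈ Finset.Nat.antidiagonalTuple 4 n, ∏ i, coeff (t i) (f i) = coeff n (∏ i, f i) := by
  rw [coeff_prod]
  refine sum_nbij' (fun t ↦ Finsupp.equivFunOnFinite.symm t) (fun t ↦ t) ?_ ?_ ?_ ?_ ?_
  all_goals simp [Finset.Nat.mem_antidiagonalTuple, mem_finsuppAntidiag]

end PartitionHuffing

open PartitionHuffing PowerSeries

/-- Combinatorial form of the identity `H₂(1/(f₁f₁₅)) = f₆²f₁₀²/(f₁²f₃f₅f₁₅²)`.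
If `c i` counts triples `(λ, μ, ν)` of total weight `i` with `λ` having no part divisible
by `3` or `5`, `μ` a partition into distinct parts divisible by `3`, `ν` a partition into
distinct parts divisible by `5`; `t₃ k` counts partitions of `k` into parts divisible by
`3`; and `t₅ l` counts partitions of `l` into parts divisible by `5`; then the number of
pairs `(λ, μ)` with `λ` an arbitrary partition, `μ` a partition into parts divisible by
`15`, and `|λ| + |μ| = 2n`, equals `∑_{i+j+k+l=n} c i * c j * t₃ k * t₅ l`. -/
theorem huffing_two_one_over_f1_f15 (c t₃ t₅ : ℕ → ℕ)
    (hc : ∀ i, c i = Nat.card {t : Multiset ℕ × Multiset ℕ × Multiset ℕ //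
      (∀ a ∈ t.1, 0 < a ∧ ¬ 3 ∣ a ∧ ¬ 5 ∣ a) ∧
      (∀ a ∈ t.2.1, 0 < a ∧ 3 ∣ a) ∧ t.2.1.Nodup ∧
      (∀ a ∈ t.2.2, 0 < a ∧ 5 ∣ a) ∧ t.2.2.Nodup ∧
      t.1.sum + t.2.1.sum + t.2.2.sum = i})
    (ht₃ : ∀ k, t₃ k = Nat.card {mu : Multiset ℕ //
      (∀ a ∈ mu, 0 < a ∧ 3 ∣ a) ∧ mu.sum = k})
    (ht₅ : ∀ l, t₅ l = Nat.card {nu : Multiset ℕ //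
      (∀ a ∈ nu, 0 < a ∧ 5 ∣ a) ∧ nu.sum = l}) :
    ∀ n, Nat.card {p : Multiset ℕ × Multiset ℕ //
      (∀ a ∈ p.1, 0 < a) ∧ (∀ a ∈ p.2, 0 < a ∧ 15 ∣ a) ∧
      p.1.sum + p.2.sum = 2 * n} =
    ∑ t ∈ Finset.Nat.antidiagonalTuple 4 n,
      c (t 0) * c (t 1) * t₃ (t 2) * t₅ (t 3) := by
  have ha (k n : ℕ) : Finite {m : Multiset ℕ // (∀ a ∈ m, 0 < a ∧ k ∣ a) ∧ m.sum = n} :=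
    finite_multiset_sum (fun m h a ha ↦ (h a ha).1) n
  have hd (k n : ℕ) :
      Finite {m : Multiset ℕ // ((∀ a ∈ m, 0 < a ∧ k ∣ a) ∧ m.Nodup) ∧ m.sum = n} :=
    finite_multiset_sum (fun m h a ha ↦ (h.1 a ha).1) n
  have hC (i : ℕ) : (c i : ℤ) = coeff i (partSeries (fun a ↦ ¬ 3 ∣ a ∧ ¬ 5 ∣ a) *
      (distinctSeries 3 * distinctSeries 5)) := by
    rw [distinctSeries, distinctSeries, partSeries, weightSeries_mul (hd 3) (hd 5),
      weightSeries_mul (finite_multiset_sum fun m h a ha ↦ (h a ha).1)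
        (finite_weight_prod (hd 3) (hd 5)), weightSeries, coeff_mk, hc]
    simp only [and_assoc, add_assoc]
  have hT₃ (k : ℕ) : (t₃ k : ℤ) = coeff k (partSeries (3 ∣ ·)) := by
    rw [ht₃, partSeries, weightSeries, coeff_mk]
  have hT₅ (k : ℕ) : (t₅ k : ℤ) = coeff k (partSeries (5 ∣ ·)) := by
    rw [ht₅, partSeries, weightSeries, coeff_mk]
  intro n
  have h := congrArg (coeff n) evenPart_partSeries
  rw [evenPart, coeff_mk, partSeries, partSeries, weightSeries_mul (ha 1) (ha 15), weightSeries,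
    coeff_mk] at h
  simp only [one_dvd, and_true, and_assoc] at h
  rw [← Nat.cast_inj (R := ℤ), h]
  push_cast
  simp only [hC, hT₃, hT₅]
  generalize partSeries (fun a ↦ ¬ 3 ∣ a ∧ ¬ 5 ∣ a) * (distinctSeries 3 * distinctSeries 5) = A
  generalize partSeries (3 ∣ ·) = B
  generalize partSeries (5 ∣ ·) = D
  have h₄ := sum_antidiagonalTuple_four ![A, A, B, D] n
  simp only [Fin.prod_univ_four, Matrix.cons_val] at h₄
  rw [sq, ← h₄]
end
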